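/- arXiv:2007.02398 — 6 statements merged into one kernel-verified Lean document; each statement's English description precedes it below -/
import Mathlib

section
/- Let n ≥ 4 and k ≥ 2 be integers with 2k − 1 ≤ n, let a < b be real numbers, and let c₁, …, c_n be real numbers. Then there exist real numbers z₂ > z₃ > ⋯ > z_k with b > z₂ and z_k > a, with z_s ≠ 0 for all s = 2,…,k, and real numbers σ₂, …, σ_k > 0 such that c_j = Σ_{s=2}^{k} z_s^{j−1} σ_s for every j = 1, …, n, if and only if the following three conditions hold: (A₁) det {c_{i+j−1+d}}_{i,j=1}^{k} = 0 for every integer d with 0 ≤ d ≤ n + 1 − 2k; (A₂) the (k−1)×(k−1) Hankel matrices {c_{i+j−1}}_{i,j=1}^{k−1} and {c_{i+j+1}}_{i,j=1}^{k−1} are positive definite; (A₃) the (k−1)×(k−1) Hankel matrix {c^{a,b}_{i+j−1}}_{i,j=1}^{k−1} is positive definite. -/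
open Finset

section

open Polynomial

/-- The linear functional on polynomials with prescribed moments. -/
noncomputable def momentFunctional (γ : ℕ → ℝ) : ℝ[X] →ₗ[ℝ] ℝ :=
  lsum fun i => LinearMap.lsmul ℝ ℝ (γ i)

theorem momentFunctional_X_pow (γ : ℕ → ℝ) (j : ℕ) : momentFunctional γ (X ^ j) = γ j := by
  simp [momentFunctional, X_pow_eq_monomial]

/-- The functional `f ↦ ∑ s ∈ S, w s * f (z s)`. -/
noncomputable def atomicFunctional {ι : Type*} (S : Finset ι) (z w : ι → ℝ) : ℝ[X] →ₗ[ℝ] ℝ :=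
  ∑ s ∈ S, w s • leval (z s)

theorem atomicFunctional_apply {ι : Type*} (S : Finset ι) (z w : ι → ℝ) (f : ℝ[X]) :
    atomicFunctional S z w f = ∑ s ∈ S, w s * f.eval (z s) := by
  simp [atomicFunctional, LinearMap.sum_apply, leval_apply]

theorem exists_ofFn_eq {M : ℕ} {g : ℝ[X]} (hg : g.degree < M) : ∃ x, ofFn M x = g := by
  refine ⟨fun i => g.coeff i, ?_⟩
  ext i
  by_cases hi : i < M
  · rw [ofFn_coeff_eq_val_of_lt _ hi]
  · rw [ofFn_coeff_eq_zero_of_ge _ (not_lt.1 hi), coeff_eq_zero_of_degree_lt]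
    exact hg.trans_le (by exact_mod_cast not_lt.1 hi)

theorem ofFn_ne_zero_iff {M : ℕ} {x : Fin M → ℝ} : ofFn M x ≠ 0 ↔ x ≠ 0 :=
  (map_ne_zero_iff _ (injective_ofFn M))

theorem ofFn_eq_sum {M : ℕ} (x : Fin M → ℝ) : ofFn M x = ∑ i, x i • X ^ i.1 := by
  rw [ofFn_eq_sum_monomial]
  simp [smul_X_eq_monomial]

theorem hankel_mulVec (L : ℝ[X] →ₗ[ℝ] ℝ) (W : ℝ[X]) {M : ℕ} (x : Fin M → ℝ) (i : Fin M) :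
    ((Matrix.of fun i j : Fin M => L (W * X ^ (i.1 + j.1))).mulVec x) i
      = L (W * X ^ i.1 * ofFn M x) := by
  simp only [Matrix.mulVec, dotProduct, Matrix.of_apply, ofFn_eq_sum, mul_sum, map_sum,
    mul_smul_comm, map_smul, smul_eq_mul, pow_add, mul_assoc]
  exact sum_congr rfl fun j _ => mul_comm _ _

theorem hankel_posDef_iff (L : ℝ[X] →ₗ[ℝ] ℝ) (W : ℝ[X]) (M : ℕ) :
    (Matrix.of fun i j : Fin M => L (W * X ^ (i.1 + j.1))).PosDef ↔
      ∀ g : ℝ[X], g ≠ 0 → g.degree < M → 0 < L (W * g ^ 2) := by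
  have key (x : Fin M → ℝ) :
      star x ⬝ᵥ ((Matrix.of fun i j : Fin M => L (W * X ^ (i.1 + j.1))).mulVec x)
        = L (W * ofFn M x ^ 2) := by
    simp only [dotProduct, hankel_mulVec, star_trivial]
    conv_rhs => rw [pow_two, ← mul_assoc, mul_comm W, mul_assoc]
    nth_rewrite 2 [ofFn_eq_sum]
    simp only [sum_mul, map_sum, smul_mul_assoc, map_smul, smul_eq_mul]
    exact sum_congr rfl fun i _ => by rw [← mul_assoc (X ^ i.1), mul_comm W]
  rw [Matrix.posDef_iff_dotProduct_mulVec]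
  constructor
  · rintro ⟨-, h⟩ g hg hdeg
    obtain ⟨x, rfl⟩ := exists_ofFn_eq hdeg
    rw [← key]
    exact h (ofFn_ne_zero_iff.1 hg)
  · intro h
    refine ⟨?_, fun x hx => ?_⟩
    · ext i j
      simp [add_comm]
    · rw [key]
      exact h _ (ofFn_ne_zero_iff.2 hx) (ofFn_degree_lt x)

theorem hankel_det_eq_zero_iff (L : ℝ[X] →ₗ[ℝ] ℝ) (W : ℝ[X]) (M : ℕ) :
    (Matrix.of fun i j : Fin M => L (W * X ^ (i.1 + j.1))).det = 0 ↔
      ∃ g : ℝ[X], g ≠ 0 ∧ g.degree < M ∧ ∀ i < M, L (W * X ^ i * g) = 0 := by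
  rw [← Matrix.exists_mulVec_eq_zero_iff]
  constructor
  · rintro ⟨x, hx, h⟩
    refine ⟨ofFn M x, ofFn_ne_zero_iff.2 hx, ofFn_degree_lt x, fun i hi => ?_⟩
    rw [← hankel_mulVec L W x ⟨i, hi⟩, h, Pi.zero_apply]
  · rintro ⟨g, hg, hdeg, h⟩
    obtain ⟨x, rfl⟩ := exists_ofFn_eq hdeg
    exact ⟨x, ofFn_ne_zero_iff.1 hg, funext fun i => by rw [hankel_mulVec]; exact h i i.2⟩

theorem map_eq_zero_of_degree_lt (L : ℝ[X] →ₗ[ℝ] ℝ) (W : ℝ[X]) {M : ℕ}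
    (h : ∀ i < M, L (W * X ^ i) = 0) {q : ℝ[X]} (hq : q.degree < M) : L (W * q) = 0 := by
  obtain ⟨x, rfl⟩ := exists_ofFn_eq hq
  simp only [ofFn_eq_sum, mul_sum, map_sum, mul_smul_comm, map_smul]
  exact sum_eq_zero fun i _ => by rw [h i i.2, smul_zero]

theorem atomicFunctional_hankel_posDef {ι : Type*} {S : Finset ι} {z w : ι → ℝ} {m : ℕ}
    (hS : #S = m) (hz : Set.InjOn z S) (hw : ∀ s ∈ S, 0 < w s) (W : ℝ[X]) (hW : ∀ s ∈ S, 0 < W.eval (z s)) :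
    (Matrix.of fun i j : Fin m => atomicFunctional S z w (W * X ^ (i.1 + j.1))).PosDef := by
  subst hS
  rw [hankel_posDef_iff]
  intro g hg hdeg
  rw [atomicFunctional_apply]
  simp only [eval_mul, eval_pow]
  refine sum_pos' (fun s hs => ?_) ?_
  · have := hw s hs
    have := hW s hs
    positivity
  · by_contra! hcon
    refine hg (eq_zero_of_degree_lt_of_eval_index_eq_zero S hz hdeg fun s hs => ?_)
    by_contra hne
    have := hw s hs
    have := hW s hs
    have : 0 < w s * (W.eval (z s) * g.eval (z s) ^ 2) := by positivity
    exact absurd (hcon s hs) this.not_ge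

theorem atomicFunctional_hankel_det {ι : Type*} {S : Finset ι} (z w : ι → ℝ) {m : ℕ}
    (hS : #S = m) (W : ℝ[X]) :
    (Matrix.of fun i j : Fin (m + 1) =>
      atomicFunctional S z w (W * X ^ (i.1 + j.1))).det = 0 := by
  subst hS
  rw [hankel_det_eq_zero_iff]
  refine ⟨∏ s ∈ S, (X - C (z s)), (monic_prod_X_sub_C z S).ne_zero, ?_, fun i _ => ?_⟩
  · rw [degree_prod]
    simp only [degree_X_sub_C, sum_const, nsmul_eq_mul, mul_one]
    exact_mod_cast Nat.lt_succ_self _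
  · rw [atomicFunctional_apply]
    refine sum_eq_zero fun s hs => ?_
    rw [eval_mul, eval_prod, prod_eq_zero hs (by simp)]
    simp

theorem real_roots_of_orthogonal (L : ℝ[X] →ₗ[ℝ] ℝ) {m : ℕ} {p : ℝ[X]} (hp : p.degree = m)
    (horth : ∀ q : ℝ[X], q.degree < m → L (p * q) = 0)
    (hpos : ∀ g : ℝ[X], g ≠ 0 → g.degree < m → 0 < L (g ^ 2)) :
    p.Splits ∧ p.roots.Nodup := by
  have hp0 : p ≠ 0 := by rintro rfl; simp at hp
  have key (α β : ℝ) (q : ℝ[X]) (h : p = ((X - C α) ^ 2 + C (β ^ 2)) * q) : False := by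
    have hq0 : q ≠ 0 := by rintro rfl; simp_all
    have hX : (X - C α : ℝ[X]) ≠ 0 := X_sub_C_ne_zero α
    have hdeg2 : ((X - C α) ^ 2 + C (β ^ 2) : ℝ[X]).natDegree = 2 := by
      rw [natDegree_add_C, natDegree_pow, natDegree_X_sub_C]
    have hQ0 : ((X - C α) ^ 2 + C (β ^ 2) : ℝ[X]) ≠ 0 := fun h0 => by
      rw [h0, natDegree_zero] at hdeg2
      omega
    have hd : 2 + q.natDegree = m := by
      rw [degree_eq_natDegree hp0] at hp
      have hp' : p.natDegree = m := by exact_mod_cast hp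
      rw [← hp', h, natDegree_mul hQ0 hq0, hdeg2]
    have hqd : q.degree < m := by
      rw [degree_eq_natDegree hq0]; exact_mod_cast (by omega : q.natDegree < m)
    have hqd' : ((X - C α : ℝ[X]) * q).degree < (m : WithBot ℕ) := by
      rw [degree_eq_natDegree (mul_ne_zero hX hq0), natDegree_mul hX hq0, natDegree_X_sub_C]
      exact_mod_cast (by omega : 1 + q.natDegree < m)
    have h1 := horth q hqd
    have h2 := hpos _ (mul_ne_zero hX hq0) hqd'
    have h3 := hpos _ hq0 hqd
    have h4 : p * q = ((X - C α) * q) ^ 2 + β ^ 2 • q ^ 2 := by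
      rw [h, smul_eq_C_mul]; ring
    rw [h4, map_add, map_smul, smul_eq_mul] at h1
    nlinarith [mul_nonneg (sq_nonneg β) h3.le]
  have hsplit : p.Splits := by
    obtain ⟨u, hu⟩ := UniqueFactorizationMonoid.factors_prod hp0
    rw [← hu]
    refine (Splits.multisetProd fun g hgmem => Splits.of_degree_eq_one ?_).mul u.isUnit.splits
    have hg := UniqueFactorizationMonoid.irreducible_of_factor g hgmem
    have hgp := UniqueFactorizationMonoid.dvd_of_mem_factors hgmem
    obtain ⟨ζ, hζ⟩ := IsAlgClosed.exists_aeval_eq_zero (k := ℂ) g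
      (degree_pos_of_ne_zero_of_nonunit hg.ne_zero hg.not_isUnit).ne'
    by_cases him : ζ.im = 0
    · refine degree_eq_one_of_irreducible_of_root hg (x := ζ.re) ?_
      have hre : ζ = algebraMap ℝ ℂ ζ.re := by
        apply Complex.ext <;> simp [him]
      rw [hre, aeval_algebraMap_apply] at hζ
      simpa using hζ
    · obtain ⟨q, hq⟩ := (quadratic_dvd_of_aeval_eq_zero_im_ne_zero g hζ him).trans hgp
      refine (key ζ.re ζ.im q ?_).elim
      rw [hq, Complex.sq_norm, Complex.normSq_apply]
      congr 1
      simp only [C_mul, C_add, C_pow, map_ofNat]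
      ring
  refine ⟨hsplit, Multiset.nodup_iff_count_le_one.2 fun α => ?_⟩
  by_contra! hcount
  rw [count_roots] at hcount
  obtain ⟨q, hq⟩ := (pow_dvd_pow (X - C α) hcount).trans (pow_rootMultiplicity_dvd p α)
  exact key α 0 q (by simpa using hq)

theorem exists_gauss_quadrature (L : ℝ[X] →ₗ[ℝ] ℝ) {m : ℕ} {p : ℝ[X]} (hp0 : p ≠ 0)
    (hp : p.degree < (m + 1 : ℕ))
    (horth : ∀ q : ℝ[X], q.degree < (m + 1 : ℕ) → L (p * q) = 0)
    (hpos : ∀ g : ℝ[X], g ≠ 0 → g.degree < m → 0 < L (g ^ 2)) :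
    ∃ (S : Finset ℝ) (w : ℝ → ℝ), #S = m ∧
      ∀ f : ℝ[X], f.natDegree ≤ 2 * m → L f = atomicFunctional S id w f := by
  have hpm : p.degree = m := by
    rw [degree_eq_natDegree hp0] at hp ⊢
    have hle : p.natDegree < m + 1 := by exact_mod_cast hp
    have : ¬ p.natDegree < m := fun hlt => by
      have hd : p.degree < m := by rw [degree_eq_natDegree hp0]; exact_mod_cast hlt
      have h1 := hpos p hp0 hd
      rw [pow_two, horth p (hd.trans (by exact_mod_cast m.lt_succ_self))] at h1
      exact h1.false
    exact_mod_cast (by omega : p.natDegree = m)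
  obtain ⟨hsplit, hnodup⟩ := real_roots_of_orthogonal L hpm
    (fun q hq => horth q (hq.trans (by exact_mod_cast m.lt_succ_self))) hpos
  have hcard : #p.roots.toFinset = m := by
    rw [Multiset.toFinset_card_of_nodup hnodup, splits_iff_card_roots.1 hsplit]
    exact natDegree_eq_of_degree_eq_some hpm
  refine ⟨p.roots.toFinset, fun x => L (Lagrange.basis p.roots.toFinset id x), hcard,
    fun f hf => ?_⟩
  have hdiv := EuclideanDomain.div_add_mod f p
  have hquot : (f / p).degree < (m + 1 : ℕ) := by
    by_cases hle : p.degree ≤ f.degree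
    · have hadd := degree_add_div hp0 hle
      by_cases hz : f / p = 0
      · rw [hz, degree_zero]; exact WithBot.bot_lt_coe _
      · have hf0 : f ≠ 0 := by rintro rfl; simp at hz
        rw [hpm, degree_eq_natDegree hz, degree_eq_natDegree hf0] at hadd
        rw [degree_eq_natDegree hz]
        have hadd' : m + (f / p).natDegree = f.natDegree := by exact_mod_cast hadd
        exact_mod_cast (by omega : (f / p).natDegree < m + 1)
    · rw [(Polynomial.div_eq_zero_iff hp0).2 (not_le.1 hle), degree_zero]
      exact WithBot.bot_lt_coe _
  have hmod : (f % p).degree < #p.roots.toFinset := by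
    rw [hcard, ← hpm]; exact degree_mod_lt f hp0
  have hLf : L f = L (f % p) := by
    conv_lhs => rw [← hdiv, map_add, horth _ hquot, zero_add]
  have heval : ∀ x ∈ p.roots.toFinset, (f % p).eval x = f.eval x := fun x hx => by
    have hx0 : p.eval x = 0 := (mem_roots hp0).1 (Multiset.mem_toFinset.1 hx)
    conv_rhs => rw [← hdiv, eval_add, eval_mul, hx0, zero_mul, zero_add]
  rw [hLf, Lagrange.eq_interpolate (v := id) Function.injective_id.injOn hmod,
    Lagrange.interpolate_apply, map_sum, atomicFunctional_apply]
  refine sum_congr rfl fun x hx => ?_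
  rw [← smul_eq_C_mul, map_smul, smul_eq_mul, mul_comm, id, heval x hx]

/-- If `L` agrees with an atomic functional with `m` nonzero atoms of nonzero weight up to
degree `2m`, then vanishing of the shifted Hankel determinants propagates the agreement. -/
theorem eq_atomicFunctional_of_hankel_det (L : ℝ[X] →ₗ[ℝ] ℝ) {m N : ℕ} {S : Finset ℝ} {w : ℝ → ℝ}
    (hS : #S = m) (hS0 : ∀ x ∈ S, x ≠ 0) (hw : ∀ x ∈ S, w x ≠ 0)
    (hL : ∀ f : ℝ[X], f.natDegree ≤ 2 * m → L f = atomicFunctional S id w f)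
    (hdet : ∀ d, 2 * m + d ≤ N →
      (Matrix.of fun i j : Fin (m + 1) => L (X ^ d * X ^ (i.1 + j.1))).det = 0)
    (j : ℕ) (hj : j ≤ N) : L (X ^ j) = atomicFunctional S id w (X ^ j) := by
  induction j using Nat.strong_induction_on with
  | _ j ih =>
    by_cases hjm : j ≤ 2 * m
    · exact hL _ (by rwa [natDegree_X_pow])
    obtain ⟨d, rfl⟩ := Nat.exists_eq_add_of_lt (not_le.1 hjm)
    obtain ⟨g, hg0, hgdeg, hg⟩ := (hankel_det_eq_zero_iff _ _ _).1 (hdet (d + 1) (by omega))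
    set Λ := atomicFunctional S id w
    have hlow : ∀ i < m, Λ (X ^ (d + 1) * g * X ^ i) = 0 := fun i hi => by
      have hE : (L - Λ) (X ^ (d + 1 + i) * g) = 0 := by
        refine map_eq_zero_of_degree_lt _ _ (fun l hl => ?_) hgdeg
        rw [← pow_add, LinearMap.sub_apply, ih _ (by omega) (by omega), sub_self]
      rw [LinearMap.sub_apply, pow_add, hg i (by omega), zero_sub, neg_eq_zero] at hE
      rw [← hE]; ring_nf
    have hroot : ∀ x ∈ S, g.eval x = 0 := fun x hx => by
      have h := map_eq_zero_of_degree_lt Λ _ hlow (q := Lagrange.basis S id x) (by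
        rw [Lagrange.degree_basis Function.injective_id.injOn hx, hS]
        have := card_pos.2 ⟨x, hx⟩
        exact_mod_cast (by omega : m - 1 < m))
      rw [atomicFunctional_apply, sum_eq_single_of_mem x hx] at h
      · have hb := Lagrange.eval_basis_self (v := id) Function.injective_id.injOn hx
        simp only [id] at h hb
        rw [eval_mul, eval_mul, hb, eval_pow, eval_X] at h
        simpa [hw x hx, hS0 x hx] using h
      · intro y hy hyx
        have hb := Lagrange.eval_basis_of_ne (s := S) (v := id) hyx.symm hy
        rw [eval_mul, hb]
        simp
    have hcoeff : g.coeff m ≠ 0 := fun h0 => hg0 <| by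
      refine eq_zero_of_degree_lt_of_eval_finset_eq_zero S ?_ hroot
      rw [hS, degree_lt_iff_coeff_zero]
      intro l hl
      rcases hl.eq_or_lt with rfl | hl
      · exact h0
      · exact coeff_eq_zero_of_degree_lt (hgdeg.trans_le (by exact_mod_cast hl))
    have hE : (L - Λ) (X ^ (d + 1 + m) * g) = 0 := by
      rw [LinearMap.sub_apply, pow_add, hg m (by omega), atomicFunctional_apply, zero_sub,
        neg_eq_zero]
      exact sum_eq_zero fun x hx => by rw [id, eval_mul, hroot x hx]; simp
    have hrest : (L - Λ) (X ^ (d + 1 + m) * (g - C (g.coeff m) * X ^ m)) = 0 := by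
      refine map_eq_zero_of_degree_lt (M := m) _ _ (fun l hl => ?_) ?_
      · rw [← pow_add, LinearMap.sub_apply, ih _ (by omega) (by omega), sub_self]
      · rw [degree_lt_iff_coeff_zero]
        intro l hl
        rcases hl.eq_or_lt with rfl | hl
        · simp
        · rw [coeff_sub, coeff_C_mul_X_pow, if_neg hl.ne', sub_zero]
          exact coeff_eq_zero_of_degree_lt (hgdeg.trans_le (by exact_mod_cast hl))
    rw [mul_sub, map_sub, hE, zero_sub, neg_eq_zero, ← smul_eq_C_mul, mul_smul_comm, map_smul,
      smul_eq_mul, mul_eq_zero, or_iff_right hcoeff, ← pow_add, LinearMap.sub_apply,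
      sub_eq_zero] at hrest
    rwa [show 2 * m + d + 1 = d + 1 + m + m by ring]

theorem exists_decreasing_enumeration {S : Finset ℝ} {m : ℕ} (hS : #S = m) :
    ∃ z : ℕ → ℝ, (∀ s ∈ Icc 2 (m + 1), z s ∈ S) ∧
      (∀ s ∈ Icc 2 (m + 1), ∀ t ∈ Icc 2 (m + 1), s < t → z t < z s) ∧
      ∀ x ∈ S, ∃ s ∈ Icc 2 (m + 1), z s = x := by
  have hlt {s : ℕ} (hs : s ∈ Icc 2 (m + 1)) : m + 1 - s < m := by
    rw [mem_Icc] at hs; omega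
  refine ⟨fun s => if hs : s ∈ Icc 2 (m + 1) then S.orderEmbOfFin hS ⟨m + 1 - s, hlt hs⟩ else 0,
    fun s hs => ?_, fun s hs t ht hst => ?_, fun x hx => ?_⟩
  · simp only [dif_pos hs]
    exact S.orderEmbOfFin_mem hS _
  · simp only [dif_pos hs, dif_pos ht]
    refine (S.orderEmbOfFin hS).strictMono ?_
    rw [Fin.mk_lt_mk]
    rw [mem_Icc] at hs ht
    omega
  · have hx' : x ∈ Set.range (S.orderEmbOfFin hS) := by rwa [range_orderEmbOfFin]
    obtain ⟨i, rfl⟩ := hx'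
    have hs : m + 1 - i.1 ∈ Icc 2 (m + 1) := by
      rw [mem_Icc]
      omega
    refine ⟨_, hs, ?_⟩
    simp only [dif_pos hs]
    congr 1
    ext
    change m + 1 - (m + 1 - i.1) = i.1
    omega

theorem map_interval_quadratic_mul_X_pow (L : ℝ[X] →ₗ[ℝ] ℝ) (a b : ℝ) (i : ℕ) :
    L ((C b - X) * (X - C a) * X ^ i)
      = -L (X ^ (i + 2)) + (a + b) * L (X ^ (i + 1)) - a * b * L (X ^ i) := by
  have h : (C b - X) * (X - C a) * X ^ i
      = -X ^ (i + 2) + (a + b) • X ^ (i + 1) - (a * b) • X ^ i := by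
    simp only [smul_eq_C_mul, C_add, C_mul]
    ring
  rw [h, map_sub, map_add, map_neg, map_smul, map_smul, smul_eq_mul, smul_eq_mul]

theorem atomicFunctional_moment_conditions {ι : Type*} {S : Finset ι} {z w : ι → ℝ} {m N : ℕ}
    {a b : ℝ} {c : ℕ → ℝ} (hS : #S = m) (hz : Set.InjOn z S) (hw : ∀ s ∈ S, 0 < w s)
    (hza : ∀ s ∈ S, a < z s) (hzb : ∀ s ∈ S, z s < b) (hz0 : ∀ s ∈ S, z s ≠ 0)
    (hm : 2 * m ≤ N)
    (hc : ∀ j ≤ N, c (j + 1) = atomicFunctional S z w (X ^ j)) :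
    (∀ d : ℕ, 2 * m + d ≤ N →
        (Matrix.of fun i j : Fin (m + 1) => c (i.1 + j.1 + 1 + d)).det = 0) ∧
      (Matrix.of fun i j : Fin m => c (i.1 + j.1 + 1)).PosDef ∧
      (Matrix.of fun i j : Fin m => c (i.1 + j.1 + 3)).PosDef ∧
      (Matrix.of fun i j : Fin m =>
        -c (i.1 + j.1 + 3) + (a + b) * c (i.1 + j.1 + 2) - a * b * c (i.1 + j.1 + 1)).PosDef := by
  refine ⟨fun d hd => ?_, ?_, ?_, ?_⟩
  · convert atomicFunctional_hankel_det z w hS (X ^ d) using 5 with i j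
    rw [← pow_add, ← hc _ (by omega)]
    congr 1
    ring
  · convert atomicFunctional_hankel_posDef hS hz hw 1 (by simp) using 4 with i j
    rw [one_mul, ← hc _ (by omega)]
  · convert atomicFunctional_hankel_posDef hS hz hw (X ^ 2) (fun s hs => ?_) using 4 with i j
    · rw [← pow_add, ← hc _ (by omega)]
      congr 1
      ring
    · have := hz0 s hs
      rw [eval_pow, eval_X]
      positivity
  · convert atomicFunctional_hankel_posDef hS hz hw ((C b - X) * (X - C a)) (fun s hs => ?_)
      using 4 with i j
    · rw [map_interval_quadratic_mul_X_pow, ← hc _ (by omega), ← hc _ (by omega),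
        ← hc _ (by omega)]
    · have := hza s hs
      have := hzb s hs
      simp only [eval_mul, eval_sub, eval_C, eval_X]
      exact mul_pos (by linarith) (by linarith)

theorem exists_atomicFunctional_of_moment_conditions {m N : ℕ} {a b : ℝ} {c : ℕ → ℝ} (hab : a < b)
    (hm : 2 * m ≤ N)
    (hdet : ∀ d : ℕ, 2 * m + d ≤ N →
        (Matrix.of fun i j : Fin (m + 1) => c (i.1 + j.1 + 1 + d)).det = 0)
    (hpos : (Matrix.of fun i j : Fin m => c (i.1 + j.1 + 1)).PosDef)
    (hpos2 : (Matrix.of fun i j : Fin m => c (i.1 + j.1 + 3)).PosDef)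
    (hposab : (Matrix.of fun i j : Fin m =>
        -c (i.1 + j.1 + 3) + (a + b) * c (i.1 + j.1 + 2) - a * b * c (i.1 + j.1 + 1)).PosDef) :
    ∃ (S : Finset ℝ) (w : ℝ → ℝ), #S = m ∧ (∀ x ∈ S, 0 < w x) ∧ (∀ x ∈ S, x ≠ 0) ∧
      (∀ x ∈ S, a < x) ∧ (∀ x ∈ S, x < b) ∧
      ∀ j ≤ N, c (j + 1) = atomicFunctional S id w (X ^ j) := by
  set L := momentFunctional fun j => c (j + 1)
  have hLX (j : ℕ) : L (X ^ j) = c (j + 1) := momentFunctional_X_pow _ j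
  have hdet' : ∀ d, 2 * m + d ≤ N →
      (Matrix.of fun i j : Fin (m + 1) => L (X ^ d * X ^ (i.1 + j.1))).det = 0 := fun d hd => by
    rw [← hdet d hd]
    congr 2
    ext i j
    rw [← pow_add, hLX]
    congr 1
    ring
  have hpos' : ∀ g : ℝ[X], g ≠ 0 → g.degree < m → 0 < L (g ^ 2) := fun g hg hd => by
    have h : (Matrix.of fun i j : Fin m => L (1 * X ^ (i.1 + j.1))).PosDef := by
      simpa only [one_mul, hLX] using hpos
    simpa using (hankel_posDef_iff L 1 m).1 h g hg hd
  have hpos2' : ∀ g : ℝ[X], g ≠ 0 → g.degree < m → 0 < L (X ^ 2 * g ^ 2) := by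
    rw [← hankel_posDef_iff]
    convert hpos2 using 4 with i j
    rw [← pow_add, hLX]
    congr 1
    ring
  have hposab' : ∀ g : ℝ[X], g ≠ 0 → g.degree < m →
      0 < L ((C b - X) * (X - C a) * g ^ 2) := by
    rw [← hankel_posDef_iff]
    convert hposab using 4 with i j
    rw [map_interval_quadratic_mul_X_pow, hLX, hLX, hLX]
  obtain ⟨p, hp0, hp, hpL⟩ := (hankel_det_eq_zero_iff _ _ _).1 (hdet' 0 (by omega))
  obtain ⟨S, w, hS, hL⟩ := exists_gauss_quadrature L hp0 hp
    (fun q hq => map_eq_zero_of_degree_lt L p (fun i hi => by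
      rw [← hpL i hi, pow_zero, one_mul, mul_comm]) hq) hpos'
  have hbasis (W : ℝ[X]) (hW : W.natDegree ≤ 2) (x : ℝ) (hx : x ∈ S) :
      L (W * Lagrange.basis S id x ^ 2) = w x * W.eval x := by
    have hm1 := card_pos.2 ⟨x, hx⟩
    rw [hL, atomicFunctional_apply, sum_eq_single_of_mem x hx]
    · have hb := Lagrange.eval_basis_self (v := id) Function.injective_id.injOn hx
      simp only [id] at hb ⊢
      rw [eval_mul, eval_pow, hb, one_pow, mul_one]
    · intro y hy hyx
      have hb := Lagrange.eval_basis_of_ne (s := S) (v := id) hyx.symm hy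
      rw [eval_mul, eval_pow, hb]
      simp
    · refine natDegree_mul_le.trans ?_
      rw [natDegree_pow, Lagrange.natDegree_basis Function.injective_id.injOn hx]
      omega
  have hbne (x : ℝ) (hx : x ∈ S) : Lagrange.basis S id x ≠ 0 :=
    Lagrange.basis_ne_zero Function.injective_id.injOn hx
  have hbdeg (x : ℝ) (hx : x ∈ S) : (Lagrange.basis S id x).degree < m := by
    rw [Lagrange.degree_basis Function.injective_id.injOn hx, hS]
    have := card_pos.2 ⟨x, hx⟩
    exact_mod_cast (by omega : m - 1 < m)
  have hw : ∀ x ∈ S, 0 < w x := fun x hx => by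
    have h := hpos' _ (hbne x hx) (hbdeg x hx)
    rw [← one_mul (_ ^ 2), hbasis 1 (by simp) x hx] at h
    simpa using h
  have hS0 : ∀ x ∈ S, x ≠ 0 := fun x hx => by
    have h := hpos2' _ (hbne x hx) (hbdeg x hx)
    rw [hbasis _ (by simp) x hx] at h
    rintro rfl
    simp at h
  have hSab : ∀ x ∈ S, 0 < (b - x) * (x - a) := fun x hx => by
    have h := hposab' _ (hbne x hx) (hbdeg x hx)
    rw [hbasis _ (by compute_degree) x hx] at h
    simpa [hw x hx] using h
  refine ⟨S, w, hS, hw, hS0, fun x hx => ?_, fun x hx => ?_, fun j hj => ?_⟩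
  · have := hSab x hx
    by_contra! hxa
    nlinarith
  · have := hSab x hx
    by_contra! hxa
    nlinarith
  · rw [← hLX]
    exact eq_atomicFunctional_of_hankel_det L hS hS0 (fun x hx => (hw x hx).ne') hL hdet' j hj

end

/-- Part (A) of the solvability lemma for the truncated Hausdorff moment problem:
existence of a representing step function with exactly `k-1` nonzero points of growth
strictly between `a` and `b`, for moments `c₁, …, c_n`. -/
theorem stmt_0 (n k : ℕ) (hn : 4 ≤ n) (hk : 2 ≤ k) (hkn : 2 * k - 1 ≤ n)
    (a b : ℝ) (hab : a < b) (c : ℕ → ℝ) :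
    (∃ z σ : ℕ → ℝ,
      (∀ s ∈ Icc 2 k, ∀ t ∈ Icc 2 k, s < t → z t < z s) ∧
      z 2 < b ∧ a < z k ∧
      (∀ s ∈ Icc 2 k, z s ≠ 0) ∧
      (∀ s ∈ Icc 2 k, 0 < σ s) ∧
      (∀ j ∈ Icc 1 n, c j = ∑ s ∈ Icc 2 k, z s ^ (j - 1) * σ s))
    ↔
    ((∀ d : ℕ, 2 * k + d ≤ n + 1 →
        (Matrix.of fun i j : Fin k => c (i.1 + j.1 + 1 + d)).det = 0) ∧
      (Matrix.of fun i j : Fin (k - 1) => c (i.1 + j.1 + 1)).PosDef ∧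
      (Matrix.of fun i j : Fin (k - 1) => c (i.1 + j.1 + 3)).PosDef ∧
      (Matrix.of fun i j : Fin (k - 1) =>
        -c (i.1 + j.1 + 3) + (a + b) * c (i.1 + j.1 + 2) - a * b * c (i.1 + j.1 + 1)).PosDef) := by
  obtain ⟨m, rfl⟩ : ∃ m, k = m + 1 := ⟨k - 1, by omega⟩
  constructor
  · rintro ⟨z, σ, hz, hzb, hza, hz0, hσ, hc⟩
    have hcard : #(Icc 2 (m + 1)) = m := by rw [Nat.card_Icc]; omega
    have hanti : StrictAntiOn z (Icc 2 (m + 1) : Finset ℕ) := fun s hs t ht => hz s hs t ht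
    have h2 : 2 ∈ Icc 2 (m + 1) := left_mem_Icc.2 hk
    have hm : m + 1 ∈ Icc 2 (m + 1) := right_mem_Icc.2 hk
    obtain ⟨hdet, hpos⟩ := atomicFunctional_moment_conditions (a := a) (b := b) (c := c)
      (N := n - 1) hcard hanti.injOn hσ
      (fun s hs => hza.trans_le (hanti.antitoneOn hs hm (mem_Icc.1 hs).2))
      (fun s hs => (hanti.antitoneOn h2 hs (mem_Icc.1 hs).1).trans_lt hzb) hz0 (by omega)
      (fun j hj => by
        rw [hc (j + 1) (mem_Icc.2 (by omega)), atomicFunctional_apply]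
        exact sum_congr rfl fun s _ => by simp [mul_comm])
    exact ⟨fun d hd => hdet d (by omega), hpos⟩
  · rintro ⟨hdet, hpos, hpos2, hposab⟩
    obtain ⟨S, w, hS, hw, hS0, hSa, hSb, hc⟩ := exists_atomicFunctional_of_moment_conditions
      (N := n - 1) hab (by omega) (fun d hd => hdet d (by omega)) hpos hpos2 hposab
    obtain ⟨z, hzS, hz, hsurj⟩ := exists_decreasing_enumeration hS
    refine ⟨z, w ∘ z, hz, hSb _ (hzS _ (left_mem_Icc.2 hk)), hSa _ (hzS _ (right_mem_Icc.2 hk)),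
      fun s hs => hS0 _ (hzS s hs), fun s hs => hw _ (hzS s hs), fun j hj => ?_⟩
    rw [mem_Icc] at hj
    have hanti : StrictAntiOn z (Icc 2 (m + 1) : Finset ℕ) := fun s hs t ht => hz s hs t ht
    have hcj := hc (j - 1) (by omega)
    rw [Nat.sub_add_cancel hj.1, atomicFunctional_apply] at hcj
    rw [hcj]
    exact (sum_nbij z hzS hanti.injOn hsurj fun s _ => by simp [mul_comm]).symm
end

section
/- Let k ≥ 2 be an integer, let z₂, …, z_k be pairwise distinct real numbers, let σ₂, …, σ_k > 0, and set c_j = Σ_{s=2}^{k} z_s^{j−1} σ_s for j = 1, …, 2k−2. Let P(z) denote the determinant of the k×k matrix whose i-th row, for i = 1,…,k−1, is (c_i, c_{i+1}, …, c_{i+k−1}) and whose k-th row is (1, z, z², …, z^{k−1}). Then P is a polynomial of degree exactly k−1 in z whose set of real roots is exactly {z₂, …, z_k}; in particular P(z) = 0 if and only if z ∈ {z₂, …, z_k}. -/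
open Finset

/-- The left factor in the factorization of the bordered Hankel matrix through the Vandermonde
matrix of the nodes `x, w 0, …, w (n - 1)`. -/
def borderedMoment {n : ℕ} (w τ : Fin n → ℝ) : Matrix (Fin (n + 1)) (Fin (n + 1)) ℝ :=
  Matrix.of fun i s =>
    Fin.cons (α := fun _ => ℝ) (if i.1 < n then 0 else 1)
      (fun t => if i.1 < n then w t ^ i.1 * τ t else 0) s

lemma det_borderedMoment_ne_zero {n : ℕ} {w τ : Fin n → ℝ} (hw : Function.Injective w)
    (hτ : ∀ s, τ s ≠ 0) : (borderedMoment w τ).det ≠ 0 := by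
  rw [Matrix.det_succ_column_zero, Fin.sum_univ_castSucc, Finset.sum_eq_zero, zero_add]
  · have hsub : (borderedMoment w τ).submatrix (Fin.last n).succAbove Fin.succ =
        (Matrix.vandermonde w).transpose * Matrix.diagonal τ := by
      ext i s
      simp [borderedMoment, Matrix.mul_diagonal, Matrix.vandermonde_apply]
    rw [hsub, Matrix.det_mul, Matrix.det_transpose, Matrix.det_diagonal]
    refine mul_ne_zero (mul_ne_zero (by simp) (by simp [borderedMoment])) (mul_ne_zero
      (Matrix.det_vandermonde_ne_zero_iff.mpr hw) (Finset.prod_ne_zero_iff.mpr fun s _ => hτ s))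
  · intro i _
    simp [borderedMoment]

lemma det_vandermonde_cons {n : ℕ} (w : Fin n → ℝ) (x : ℝ) :
    (Matrix.vandermonde (Fin.cons x w : Fin (n + 1) → ℝ)).det =
      (-1) ^ n * (Matrix.vandermonde w).det * ∏ s, (x - w s) := by
  have h : ∏ s, (w s - x) = (-1) ^ n * ∏ s, (x - w s) := by
    rw [← Fin.prod_const, ← Finset.prod_mul_distrib]
    exact Finset.prod_congr rfl fun s _ => by ring
  simp only [Matrix.det_vandermonde, Fin.prod_univ_succ, Fin.prod_Ioi_zero, Fin.prod_Ioi_succ,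
    Fin.cons_zero, Fin.cons_succ, h]
  ring

lemma borderedMoment_mul_vandermonde {n : ℕ} (w τ : Fin n → ℝ) (x : ℝ) :
    borderedMoment w τ * Matrix.vandermonde (Fin.cons x w : Fin (n + 1) → ℝ) =
      Matrix.of fun i j : Fin (n + 1) =>
        if i.1 < n then ∑ s, w s ^ (i.1 + j.1) * τ s else x ^ j.1 := by
  ext i j
  by_cases hi : i.1 < n
  · simp only [Matrix.mul_apply, Fin.sum_univ_succ, borderedMoment, Matrix.of_apply,
      Matrix.vandermonde_apply, Fin.cons_zero, Fin.cons_succ, hi, if_true, zero_mul, zero_add]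
    exact Finset.sum_congr rfl fun s _ => by ring
  · simp [Matrix.mul_apply, Fin.sum_univ_succ, borderedMoment, Matrix.vandermonde_apply, hi,
      -Matrix.vandermonde_cons]

/-- The determinantal polynomial built from the Hankel moments of a discrete measure
with masses `σ_s` at pairwise distinct points `z_s`, `s = 2,…,k`, has degree exactly
`k-1` and its real roots are exactly the points `z₂,…,z_k`. -/
theorem stmt_1 (k : ℕ) (hk : 2 ≤ k) (z σ : ℕ → ℝ)
    (hz : ∀ s ∈ Icc 2 k, ∀ t ∈ Icc 2 k, s ≠ t → z s ≠ z t)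
    (hσ : ∀ s ∈ Icc 2 k, 0 < σ s)
    (c : ℕ → ℝ)
    (hc : ∀ j ∈ Icc 1 (2 * k - 2), c j = ∑ s ∈ Icc 2 k, z s ^ (j - 1) * σ s) :
    ∃ p : Polynomial ℝ,
      (∀ x : ℝ, p.eval x =
        (Matrix.of fun i j : Fin k =>
          if i.1 + 1 < k then c (i.1 + j.1 + 1) else x ^ j.1).det) ∧
      p.degree = (k - 1 : ℕ) ∧
      (∀ x : ℝ, p.eval x = 0 ↔ ∃ s ∈ Icc 2 k, z s = x) := by
  obtain ⟨n, rfl⟩ : ∃ n, k = n + 1 := ⟨k - 1, by omega⟩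
  let w : Fin n → ℝ := fun s => z (s + 2)
  let τ : Fin n → ℝ := fun s => σ (s + 2)
  have hmem (s : Fin n) : s.1 + 2 ∈ Icc 2 (n + 1) := by
    rw [mem_Icc]; omega
  have hw : Function.Injective w := fun s t hst => by
    by_contra hne
    exact hz _ (hmem s) _ (hmem t) (fun h => hne (Fin.ext (by omega))) hst
  have hτ (s : Fin n) : τ s ≠ 0 := (hσ _ (hmem s)).ne'
  have hsum (f : ℕ → ℝ) : ∑ s ∈ Icc 2 (n + 1), f s = ∑ s : Fin n, f (s + 2) := by
    rw [Fin.sum_univ_eq_sum_range (fun s => f (s + 2)), Finset.range_eq_Ico,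
      Finset.sum_Ico_add' f 0 n 2]
    rfl
  have hmat (x : ℝ) : (Matrix.of fun i j : Fin (n + 1) =>
      if i.1 + 1 < n + 1 then c (i.1 + j.1 + 1) else x ^ j.1) =
      borderedMoment w τ * Matrix.vandermonde (Fin.cons x w : Fin (n + 1) → ℝ) := by
    rw [borderedMoment_mul_vandermonde]
    ext i j
    by_cases hi : i.1 < n
    · have hj : i.1 + j.1 + 1 ∈ Icc 1 (2 * (n + 1) - 2) := by
        rw [mem_Icc]; omega
      simp [hi, hc _ hj, hsum, w, τ]
    · simp [hi]
  let a : ℝ := (borderedMoment w τ).det * ((-1) ^ n * (Matrix.vandermonde w).det)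
  have ha : a ≠ 0 := mul_ne_zero (det_borderedMoment_ne_zero hw hτ)
    (mul_ne_zero (by simp) (Matrix.det_vandermonde_ne_zero_iff.mpr hw))
  refine ⟨Polynomial.C a * ∏ s, (Polynomial.X - Polynomial.C (w s)), fun x => ?_, ?_, fun x => ?_⟩
  · rw [hmat, Matrix.det_mul, det_vandermonde_cons]
    simp only [Polynomial.eval_mul, Polynomial.eval_C, Polynomial.eval_prod, Polynomial.eval_sub,
      Polynomial.eval_X, a]
    ring
  · rw [Polynomial.degree_C_mul ha, Polynomial.degree_prod]
    simp
  · simp only [Polynomial.eval_mul, Polynomial.eval_C, Polynomial.eval_prod, Polynomial.eval_sub,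
      Polynomial.eval_X, mul_eq_zero, ha, false_or, Finset.prod_eq_zero_iff, sub_eq_zero]
    constructor
    · rintro ⟨s, -, rfl⟩
      exact ⟨_, hmem s, rfl⟩
    · rintro ⟨s, hs, rfl⟩
      rw [mem_Icc] at hs
      refine ⟨⟨s - 2, by omega⟩, mem_univ _, ?_⟩
      simp only [w, Nat.sub_add_cancel hs.1]
end

section
/- Let k ≥ 2 be an integer, let a < b be real numbers, let z₂, …, z_k be pairwise distinct real numbers with a < z_s < b for all s, let σ₂, …, σ_k > 0, let σ₁ ≥ 0 and σ_{k+1} ≥ 0, and set c_j = b^{j−1}σ₁ + Σ_{s=2}^{k} z_s^{j−1} σ_s + a^{j−1}σ_{k+1} for j = 1, …, 2k. Let P(z) denote the determinant of the k×k matrix whose i-th row, for i = 1,…,k−1, is (c^{a,b}_i, c^{a,b}_{i+1}, …, c^{a,b}_{i+k−1}) and whose k-th row is (1, z, z², …, z^{k−1}). Then P is a polynomial of degree exactly k−1 in z whose set of real roots is exactly {z₂, …, z_k}. -/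
open Finset

/-- The determinant whose first `m` rows are the Hankel rows of the moments of the measure with
masses `w` at `y` and whose last row is `1, x, …, x ^ m` is an explicit multiple of
`∏ s, (x - y s)`. -/
theorem det_hankel_powers (m : ℕ) (y w : Fin m → ℝ) (x : ℝ) :
    (Matrix.of fun i j : Fin (m + 1) =>
      if i.1 < m then ∑ s, w s * y s ^ (i.1 + j.1) else x ^ j.1).det =
      (∏ s, w s) * (Matrix.vandermonde y).det ^ 2 * ∏ s, (x - y s) := by
  set A : Matrix (Fin (m + 1)) (Fin (m + 1)) ℝ := Matrix.of fun i s =>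
    Fin.cons (α := fun _ => ℝ) (if i.1 < m then 0 else 1)
      (fun t => if i.1 < m then w t * y t ^ i.1 else 0) s with hA
  have hmul : (Matrix.of fun i j : Fin (m + 1) =>
      if i.1 < m then ∑ s, w s * y s ^ (i.1 + j.1) else x ^ j.1) =
      A * Matrix.vandermonde (Fin.cons x y : Fin (m + 1) → ℝ) := by
    ext i j
    rw [Matrix.mul_apply, Fin.sum_univ_succ]
    by_cases h : i.1 < m
    · simp [hA, h, Matrix.vandermonde_apply, pow_add, mul_assoc]
    · simp [hA, h, Matrix.vandermonde_apply]
  have hsub : A.submatrix (Fin.last m).succAbove (0 : Fin (m + 1)).succAbove =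
      (Matrix.vandermonde y).transpose * Matrix.diagonal w := by
    ext i j
    simp [hA, Matrix.vandermonde_apply, Matrix.mul_diagonal, mul_comm]
  have hdetA : A.det = (-1) ^ m * ((Matrix.vandermonde y).det * ∏ s, w s) := by
    rw [Matrix.det_succ_row A (Fin.last m), Fin.sum_univ_succ, hsub]
    simp [hA]
  have hvand : (Matrix.vandermonde (Fin.cons x y : Fin (m + 1) → ℝ)).det =
      (-1) ^ m * (∏ s, (x - y s)) * (Matrix.vandermonde y).det := by
    have hneg : ∏ s, (y s - x) = (-1) ^ m * ∏ s, (x - y s) := by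
      simp_rw [← neg_sub x, Finset.prod_neg, Finset.card_univ, Fintype.card_fin]
    rw [← hneg, Matrix.det_vandermonde, Matrix.det_vandermonde, Fin.prod_univ_succ]
    simp [Fin.prod_Ioi_succ]
  have hsq : ((-1 : ℝ) ^ m) * (-1) ^ m = 1 := by
    rw [← mul_pow]; simp
  rw [hmul, Matrix.det_mul, hdetA, hvand]
  linear_combination ((∏ s, w s) * (Matrix.vandermonde y).det ^ 2 * ∏ s, (x - y s)) * hsq

/-- The determinantal polynomial built from the transformed moments
`c^{a,b}_j = -c_{j+2} + (a+b)c_{j+1} - ab·c_j` of a discrete measure with masses at `b`,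
at pairwise distinct interior points `z₂,…,z_k`, and at `a`, has degree exactly `k-1`
and its real roots are exactly `z₂,…,z_k`. -/
theorem stmt_3 (k : ℕ) (hk : 2 ≤ k) (a b : ℝ) (hab : a < b) (z σ : ℕ → ℝ)
    (hz : ∀ s ∈ Icc 2 k, ∀ t ∈ Icc 2 k, s ≠ t → z s ≠ z t)
    (hzab : ∀ s ∈ Icc 2 k, a < z s ∧ z s < b)
    (hσ : ∀ s ∈ Icc 2 k, 0 < σ s)
    (hσ1 : 0 ≤ σ 1) (hσk1 : 0 ≤ σ (k + 1))
    (c : ℕ → ℝ)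
    (hc : ∀ j ∈ Icc 1 (2 * k), c j =
      b ^ (j - 1) * σ 1 + (∑ s ∈ Icc 2 k, z s ^ (j - 1) * σ s) + a ^ (j - 1) * σ (k + 1)) :
    ∃ p : Polynomial ℝ,
      (∀ x : ℝ, p.eval x =
        (Matrix.of fun i j : Fin k =>
          if i.1 + 1 < k then
            -c (i.1 + j.1 + 3) + (a + b) * c (i.1 + j.1 + 2) - a * b * c (i.1 + j.1 + 1)
          else x ^ j.1).det) ∧
      p.degree = (k - 1 : ℕ) ∧
      (∀ x : ℝ, p.eval x = 0 ↔ ∃ s ∈ Icc 2 k, z s = x) := by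
  obtain ⟨m, rfl⟩ : ∃ m, k = m + 1 := ⟨k - 1, by omega⟩
  set y : Fin m → ℝ := fun s => z (s.1 + 2) with hy
  set w : Fin m → ℝ := fun s => σ (s.1 + 2) * ((y s - a) * (b - y s)) with hw
  have hmem (s : Fin m) : s.1 + 2 ∈ Icc 2 (m + 1) := by
    have := s.2
    simp only [mem_Icc]; omega
  have hsum (f : ℕ → ℝ) : ∑ s ∈ Icc 2 (m + 1), f s = ∑ s : Fin m, f (s.1 + 2) := by
    rw [Fin.sum_univ_eq_sum_range (fun s => f (s + 2)), ← Finset.Ico_add_one_right_eq_Icc,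
      Finset.sum_Ico_eq_sum_range]
    rw [show m + 1 + 1 - 2 = m by omega]
    simp only [add_comm]
  have hwpos (s : Fin m) : 0 < w s :=
    mul_pos (hσ _ (hmem s)) (mul_pos (sub_pos.2 (hzab _ (hmem s)).1)
      (sub_pos.2 (hzab _ (hmem s)).2))
  have hinj : Function.Injective y := by
    intro s t hst
    by_contra hne
    exact hz _ (hmem s) _ (hmem t) (fun h => hne (Fin.ext (by omega))) hst
  set K : ℝ := (∏ s, w s) * (Matrix.vandermonde y).det ^ 2 with hK
  have hK0 : K ≠ 0 := mul_ne_zero (Finset.prod_ne_zero_iff.2 fun s _ => (hwpos s).ne')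
    (pow_ne_zero _ (Matrix.det_vandermonde_ne_zero_iff.2 hinj))
  have hentry (n : ℕ) (hn : n + 3 ≤ 2 * (m + 1)) :
      -c (n + 3) + (a + b) * c (n + 2) - a * b * c (n + 1) = ∑ s, w s * y s ^ n := by
    rw [hc (n + 3) (by simp only [mem_Icc]; omega), hc (n + 2) (by simp only [mem_Icc]; omega),
      hc (n + 1) (by simp only [mem_Icc]; omega), hsum, hsum, hsum]
    have hw_sum : ∑ s, w s * y s ^ n = -∑ s, y s ^ (n + 2) * σ (s.1 + 2)
        + (a + b) * ∑ s, y s ^ (n + 1) * σ (s.1 + 2)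
        - a * b * ∑ s, y s ^ n * σ (s.1 + 2) := by
      rw [Finset.mul_sum, Finset.mul_sum, ← Finset.sum_neg_distrib, ← Finset.sum_add_distrib,
        ← Finset.sum_sub_distrib]
      refine Finset.sum_congr rfl fun s _ => ?_
      simp only [hw]; ring
    rw [hw_sum]
    simp only [hy, Nat.add_sub_cancel, show n + 3 - 1 = n + 2 from rfl,
      show n + 2 - 1 = n + 1 from rfl]
    ring
  refine ⟨Polynomial.C K * ∏ s, (Polynomial.X - Polynomial.C (y s)), fun x => ?_, ?_, fun x => ?_⟩
  · have hdet := det_hankel_powers m y w x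
    rw [← hK] at hdet
    rw [Polynomial.eval_mul, Polynomial.eval_C, Polynomial.eval_prod]
    simp only [Polynomial.eval_sub, Polynomial.eval_X, Polynomial.eval_C]
    rw [← hdet]
    congr 1
    ext i j
    have := j.2
    by_cases h : i.1 < m
    · simp [h, hentry (i.1 + j.1) (by omega)]
    · simp [h]
  · rw [Polynomial.degree_C_mul hK0, Polynomial.degree_prod]
    simp
  · rw [Polynomial.eval_mul, Polynomial.eval_C, Polynomial.eval_prod, mul_eq_zero_iff_left hK0,
      Finset.prod_eq_zero_iff]
    constructor
    · rintro ⟨s, -, hs⟩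
      refine ⟨_, hmem s, ?_⟩
      simp only [Polynomial.eval_sub, Polynomial.eval_X, Polynomial.eval_C] at hs
      exact (sub_eq_zero.1 hs).symm
    · rintro ⟨s, hs, rfl⟩
      rw [mem_Icc] at hs
      refine ⟨⟨s - 2, by omega⟩, mem_univ _, ?_⟩
      simp [hy, Nat.sub_add_cancel hs.1]
end

section
/- Let n ≥ 4 and k ≥ 1 be integers with 2k ≤ n, let a < b be real numbers, and let c₁, …, c_n be real numbers. Then there exist real numbers b > z₂ > z₃ > ⋯ > z_k > a with z_s ≠ 0 for all s = 2,…,k, and real numbers σ₂, …, σ_{k+1} > 0 such that c_j = Σ_{s=2}^{k} z_s^{j−1} σ_s + a^{j−1}σ_{k+1} for every j = 1, …, n, if and only if the following three conditions hold: (D₁) det {c^{a}_{i+j−1+d}}_{i,j=1}^{k} = 0 for every integer d with 0 ≤ d ≤ n − 2k; (D₂) the (k−1)×(k−1) Hankel matrices {c^{a}_{i+j−1}}_{i,j=1}^{k−1} and {c^{a}_{i+j+1}}_{i,j=1}^{k−1} are positive definite; (D₃) the k×k Hankel matrix {c^{b}_{i+j−1}}_{i,j=1}^{k} is positive definite. 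-/
open Finset

open Matrix in
theorem posDef_hankel_iff {K : ℕ} {x w : Fin K → ℝ} (hx : Function.Injective x) :
    (Matrix.of fun i j : Fin K => ∑ s, x s ^ (i.1 + j.1) * w s).PosDef ↔ ∀ s, 0 < w s := by
  have hV : IsUnit (vandermonde x) := by
    rw [isUnit_iff_isUnit_det, isUnit_iff_ne_zero]
    exact det_vandermonde_ne_zero_iff.2 hx
  suffices h : (Matrix.of fun i j : Fin K => ∑ s, x s ^ (i.1 + j.1) * w s) =
      star (vandermonde x) * diagonal w * vandermonde x by
    rw [h, hV.posDef_star_left_conjugate_iff, posDef_diagonal_iff]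
  ext i j
  rw [mul_apply]
  simp only [of_apply, star_eq_conjTranspose, mul_diagonal, conjTranspose_apply,
    vandermonde_apply, star_trivial]
  exact sum_congr rfl fun s _ => by ring

open Matrix MatrixOrder in
/-- A positive definite and a symmetric real matrix are simultaneously congruent to the identity
and a diagonal matrix. -/
theorem exists_isUnit_transpose_mul_diagonal_mul {ι : Type*} [Fintype ι] [DecidableEq ι]
    {H T : Matrix ι ι ℝ} (hH : H.PosDef) (hT : T.IsHermitian) :
    ∃ (U : Matrix ι ι ℝ) (z : ι → ℝ), IsUnit U ∧ H = Uᴴ * U ∧ T = Uᴴ * (diagonal z * U) := by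
  obtain ⟨B, hB⟩ := CStarAlgebra.nonneg_iff_eq_star_mul_self.mp hH.posSemidef.nonneg
  have hBu : IsUnit B := by
    have := hH.isUnit
    rw [hB] at this
    rw [isUnit_iff_isUnit_det] at this ⊢
    rw [det_mul] at this
    exact isUnit_of_mul_isUnit_right this
  have hBd := (isUnit_iff_isUnit_det B).1 hBu
  have hA : ((B⁻¹)ᴴ * T * B⁻¹).IsHermitian := isHermitian_conjTranspose_mul_mul _ hT
  have hspec := hA.spectral_theorem
  rw [Unitary.conjStarAlgAut_apply] at hspec
  have hQ := Unitary.coe_star_mul_self hA.eigenvectorUnitary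
  have hQ' := Unitary.coe_mul_star_self hA.eigenvectorUnitary
  rw [Unitary.coe_star] at hQ'
  set Q : Matrix ι ι ℝ := (hA.eigenvectorUnitary : Matrix ι ι ℝ)
  have hQu : IsUnit (star Q) := IsUnit.of_mul_eq_one Q hQ
  refine ⟨star Q * B, hA.eigenvalues, hQu.mul hBu, ?_, ?_⟩
  · rw [hB, ← star_eq_conjTranspose, star_mul, star_star, mul_assoc, ← mul_assoc Q, hQ', one_mul]
  · have hT' : T = Bᴴ * ((B⁻¹)ᴴ * T * B⁻¹) * B := by
      rw [mul_assoc, mul_assoc _ B⁻¹, nonsing_inv_mul _ hBd, mul_one, ← mul_assoc,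
        ← conjTranspose_mul, nonsing_inv_mul _ hBd, conjTranspose_one, one_mul]
    refine hT'.trans ?_
    refine (congrArg (fun X => Bᴴ * X * B) hspec).trans ?_
    rw [conjTranspose_mul, ← star_eq_conjTranspose (star Q), star_star]
    simp only [mul_assoc]
    rfl

open Matrix in
/-- Gauss quadrature for a positive definite Hankel matrix. -/
theorem exists_quadrature_of_posDef_hankel {N : ℕ} {m : ℕ → ℝ}
    (h : (Matrix.of fun i j : Fin N => m (i.1 + j.1)).PosDef) :
    ∃ z w : Fin N → ℝ, Function.Injective z ∧ (∀ s, 0 < w s) ∧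
      ∀ l < 2 * N, m l = ∑ s, z s ^ l * w s := by
  cases N with
  | zero => exact ⟨0, 0, Function.injective_of_subsingleton _, fun s => s.elim0, by simp⟩
  | succ M =>
  have hT : (Matrix.of fun i j : Fin (M + 1) => m (i.1 + j.1 + 1)).IsHermitian := by
    ext i j
    simp [add_comm]
  obtain ⟨U, z, hU, hH, hT⟩ := exists_isUnit_transpose_mul_diagonal_mul h hT
  have hUd := (isUnit_iff_isUnit_det U).1 hU
  have hpow : ∀ (j : ℕ) (hj : j < M + 1) (s : Fin (M + 1)), U s ⟨j, hj⟩ = z s ^ j * U s 0 := by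
    intro j
    induction j with
    | zero => intro hj s; simp
    | succ j ih =>
      intro hj s
      have hker : Uᴴ *ᵥ (fun s => U s ⟨j + 1, hj⟩ - z s * U s ⟨j, by omega⟩) = 0 := by
        ext i
        have e1 := congrFun (congrFun hH i) ⟨j + 1, hj⟩
        have e2 := congrFun (congrFun hT i) ⟨j, by omega⟩
        simp only [of_apply, mul_apply (M := Uᴴ), diagonal_mul] at e1 e2
        simp only [mulVec, dotProduct, mul_sub, sum_sub_distrib, Pi.zero_apply]
        rw [← e1, ← e2, sub_eq_zero]
        rfl
      have h0 := eq_zero_of_mulVec_eq_zero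
        (by rw [det_conjTranspose]; simpa using hUd.ne_zero) hker
      have := congrFun h0 s
      simp only [Pi.zero_apply] at this
      rw [sub_eq_zero.1 this, ih, pow_succ]
      ring
  have hUV : U = diagonal (fun s => U s 0) * vandermonde z := by
    ext s j
    rw [diagonal_mul, vandermonde_apply, hpow j.1 j.2 s, mul_comm]
  have hne := hUd.ne_zero
  rw [hUV, det_mul, det_diagonal, mul_ne_zero_iff, prod_ne_zero_iff,
    det_vandermonde_ne_zero_iff] at hne
  refine ⟨z, fun s => U s 0 ^ 2, hne.2, fun s => ?_, fun l hl => ?_⟩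
  · have := hne.1 s (mem_univ s)
    positivity
  · have e2 : ∀ i j : Fin (M + 1), m (i.1 + j.1 + 1) = ∑ s, z s ^ (i.1 + j.1 + 1) * U s 0 ^ 2 := by
      intro i j
      have e2 := congrFun (congrFun hT i) j
      simp only [of_apply, mul_apply (M := Uᴴ), diagonal_mul, conjTranspose_apply,
        star_trivial] at e2
      rw [e2]
      refine sum_congr rfl fun s _ => ?_
      rw [hpow i.1 i.2 s, hpow j.1 j.2 s]
      ring
    rcases Nat.eq_zero_or_pos l with rfl | hl0
    · have e1 := congrFun (congrFun hH 0) 0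
      simp only [of_apply, mul_apply (M := Uᴴ), conjTranspose_apply, star_trivial] at e1
      simpa [pow_two] using e1
    · have := e2 ⟨(l - 1) / 2, by omega⟩ ⟨l - 1 - (l - 1) / 2, by omega⟩
      simpa only [show (l - 1) / 2 + (l - 1 - (l - 1) / 2) + 1 = l by omega] using this

open Matrix in
theorem eq_sum_of_det_hankel_eq_zero {N d : ℕ} {m : ℕ → ℝ} {z w : Fin N → ℝ}
    (hz : Function.Injective z) (hw : ∀ s, z s ^ d * w s ≠ 0)
    (hm : ∀ l < 2 * N + d, m l = ∑ s, z s ^ l * w s)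
    (hdet : (Matrix.of fun i j : Fin (N + 1) => m (i.1 + j.1 + d)).det = 0) :
    m (2 * N + d) = ∑ s, z s ^ (2 * N + d) * w s := by
  obtain ⟨u, hu, hMu⟩ := exists_mulVec_eq_zero_iff.2 hdet
  have hswap : ∀ i : ℕ, ∑ j : Fin (N + 1), (∑ s, z s ^ (i + j.1 + d) * w s) * u j =
      ∑ s, (z s ^ d * w s * ∑ j : Fin (N + 1), u j * z s ^ j.1) * z s ^ i := by
    intro i
    simp only [sum_mul, mul_sum]
    rw [sum_comm]
    exact sum_congr rfl fun s _ => sum_congr rfl fun j _ => by ring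
  have hq : ∀ s, ∑ j : Fin (N + 1), u j * z s ^ j.1 = 0 := by
    intro s
    have := eq_zero_of_forall_pow_sum_mul_pow_eq_zero hz
      (v := fun s => z s ^ d * w s * ∑ j : Fin (N + 1), u j * z s ^ j.1) fun i => by
        rw [← hswap]
        have := congrFun hMu i.castSucc
        simp only [mulVec, dotProduct, of_apply, Pi.zero_apply, Fin.val_castSucc] at this
        rw [← this]
        exact sum_congr rfl fun j _ => by rw [hm]; omega
    exact (mul_eq_zero.1 (congrFun this s)).resolve_left (hw s)
  have hlast : u (Fin.last N) ≠ 0 := by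
    intro h0
    have := eq_zero_of_forall_index_sum_mul_pow_eq_zero hz (v := fun i => u i.castSucc)
      fun s => by simpa [Fin.sum_univ_castSucc, h0] using hq s
    refine hu (funext fun i => ?_)
    exact Fin.lastCases h0 (fun i => congrFun this i) i
  have h1 := hswap N
  simp only [hq, mul_zero, zero_mul, sum_const_zero] at h1
  have h2 := congrFun hMu (Fin.last N)
  simp only [mulVec, dotProduct, of_apply, Pi.zero_apply, Fin.val_last] at h2
  rw [Fin.sum_univ_castSucc] at h1 h2
  have h3 : ∑ j : Fin N, m (N + j.castSucc.1 + d) * u j.castSucc =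
      ∑ j : Fin N, (∑ s, z s ^ (N + j.castSucc.1 + d) * w s) * u j.castSucc :=
    sum_congr rfl fun j _ => by rw [hm]; simp; omega
  rw [h3] at h2
  have h4 := mul_right_cancel₀ hlast (add_left_cancel (h2.trans h1.symm))
  simpa only [Fin.val_last, two_mul] using h4

open Matrix in
theorem exists_ne_zero_forall_sum_mul_pow_eq_zero {N : ℕ} (z : Fin N → ℝ) :
    ∃ v : Fin (N + 1) → ℝ, v ≠ 0 ∧ ∀ s, ∑ j, v j * z s ^ j.1 = 0 := by
  have h := LinearMap.ker_ne_bot_of_finrank_lt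
    (f := (Matrix.of fun (s : Fin N) (j : Fin (N + 1)) => z s ^ j.1).mulVecLin) (by simp)
  obtain ⟨v, hv, hv0⟩ := (Submodule.ne_bot_iff _).1 h
  refine ⟨v, hv0, fun s => ?_⟩
  have := congrFun (LinearMap.mem_ker.1 hv) s
  simpa [mulVec, dotProduct, mul_comm] using this

theorem sum_sum_pow_mul_mul_eq_zero {N K : ℕ} {z : Fin N → ℝ} {v : Fin K → ℝ}
    (hv : ∀ s, ∑ j, v j * z s ^ j.1 = 0) (w : Fin N → ℝ) (i : ℕ) :
    ∑ j : Fin K, (∑ s, z s ^ (i + j.1) * w s) * v j = 0 := by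
  have : ∑ j : Fin K, (∑ s, z s ^ (i + j.1) * w s) * v j =
      ∑ s, z s ^ i * w s * ∑ j : Fin K, v j * z s ^ j.1 := by
    simp only [sum_mul, mul_sum]
    rw [sum_comm]
    exact sum_congr rfl fun s _ => sum_congr rfl fun j _ => by ring
  simp [this, hv]

open Matrix in
theorem det_hankel_eq_zero {N : ℕ} (z w : Fin N → ℝ) :
    (Matrix.of fun i j : Fin (N + 1) => ∑ s, z s ^ (i.1 + j.1) * w s).det = 0 := by
  obtain ⟨v, hv0, hv⟩ := exists_ne_zero_forall_sum_mul_pow_eq_zero z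
  refine exists_mulVec_eq_zero_iff.1 ⟨v, hv0, funext fun i => ?_⟩
  exact sum_sum_pow_mul_mul_eq_zero hv w i

open Matrix in
theorem forall_ne_of_posDef_hankel {N : ℕ} {a b : ℝ} {c : ℕ → ℝ} {z w : Fin N → ℝ}
    (hm : ∀ l ≤ 2 * N, c (l + 2) - a * c (l + 1) = ∑ s, z s ^ l * w s)
    (h : (Matrix.of fun i j : Fin (N + 1) =>
      -c (i.1 + j.1 + 2) + b * c (i.1 + j.1 + 1)).PosDef) (s : Fin N) : z s ≠ a := by
  rintro rfl
  set a := z s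
  obtain ⟨v, hv0, hv⟩ := exists_ne_zero_forall_sum_mul_pow_eq_zero z
  have hker : ∀ i ≤ N, ∑ j : Fin (N + 1), (c (i + j.1 + 2) - a * c (i + j.1 + 1)) * v j = 0 := by
    intro i hi
    rw [← sum_sum_pow_mul_mul_eq_zero hv w i]
    exact sum_congr rfl fun j _ => by rw [hm]; omega
  have hgeom : ∀ i ≤ N, ∑ j : Fin (N + 1), c (i + j.1 + 1) * v j =
      a ^ i * ∑ j : Fin (N + 1), c (j.1 + 1) * v j := by
    intro i
    induction i with
    | zero => simp
    | succ i ih =>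
      intro hi
      have h1 := hker i (by omega)
      simp only [sub_mul, mul_assoc, sum_sub_distrib, ← mul_sum] at h1
      rw [ih (by omega)] at h1
      rw [pow_succ', mul_assoc, ← sub_eq_zero, ← h1]
      congr 1
      exact sum_congr rfl fun j _ => by rw [show i + 1 + j.1 + 1 = i + j.1 + 2 by omega]
  have hrow : ∀ i : Fin (N + 1), ∑ j : Fin (N + 1),
      (-c (i.1 + j.1 + 2) + b * c (i.1 + j.1 + 1)) * v j =
        (b - a) * (∑ j : Fin (N + 1), c (j.1 + 1) * v j) * a ^ i.1 := by
    intro i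
    have h1 := hker i.1 (by omega)
    have h2 := hgeom i.1 (by omega)
    rw [mul_assoc, mul_comm _ (a ^ i.1), ← h2, mul_sum, ← sub_eq_zero, ← neg_eq_zero,
      ← sum_sub_distrib, ← sum_neg_distrib, ← h1]
    exact sum_congr rfl fun j _ => by ring
  have hpos := h.dotProduct_mulVec_pos hv0
  simp only [dotProduct, mulVec, of_apply, star_trivial, hrow] at hpos
  refine hpos.ne' ?_
  calc _ = (b - a) * (∑ j : Fin (N + 1), c (j.1 + 1) * v j) * ∑ i, v i * a ^ i.1 := by
        rw [mul_sum univ _ (_ * _)]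
        exact sum_congr rfl fun j _ => by ring
    _ = 0 := by rw [hv s, mul_zero]

/-- Representation of the moment sequence `c` by `N` atoms in `(a, b)` and one atom at `a`. -/
theorem exists_atoms_iff {n N : ℕ} (hN : 2 * (N + 1) ≤ n) {a b : ℝ} (hab : a < b) (c : ℕ → ℝ) :
    (∃ (z τ : Fin N → ℝ) (t : ℝ), Function.Injective z ∧ (∀ s, a < z s ∧ z s < b) ∧
      (∀ s, z s ≠ 0) ∧ (∀ s, 0 < τ s) ∧ 0 < t ∧
      ∀ j < n, c (j + 1) = (∑ s, z s ^ j * τ s) + a ^ j * t) ↔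
    ((∀ d : ℕ, 2 * (N + 1) + d ≤ n →
        (Matrix.of fun i j : Fin (N + 1) =>
          c (i.1 + j.1 + 2 + d) - a * c (i.1 + j.1 + 1 + d)).det = 0) ∧
      (Matrix.of fun i j : Fin N => c (i.1 + j.1 + 2) - a * c (i.1 + j.1 + 1)).PosDef ∧
      (Matrix.of fun i j : Fin N => c (i.1 + j.1 + 4) - a * c (i.1 + j.1 + 3)).PosDef ∧
      (Matrix.of fun i j : Fin (N + 1) =>
        -c (i.1 + j.1 + 2) + b * c (i.1 + j.1 + 1)).PosDef) := by
  have hrep : ∀ {z τ : Fin N → ℝ} {t : ℝ},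
      (∀ j < n, c (j + 1) = (∑ s, z s ^ j * τ s) + a ^ j * t) → ∀ l, l + 1 < n →
      c (l + 2) - a * c (l + 1) = ∑ s, z s ^ l * ((z s - a) * τ s) := by
    intro z τ t hc l hl
    rw [hc (l + 1) hl, hc l (by omega), mul_add, mul_sum,
      show ∀ x y p q : ℝ, x + y - (p + q) = x - p + (y - q) by intros; ring, ← sum_sub_distrib,
      pow_succ' a, mul_assoc, sub_self, add_zero]
    exact sum_congr rfl fun s _ => by ring
  have hinj : ∀ {z : Fin N → ℝ}, Function.Injective z → (∀ s, z s ≠ a) →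
      Function.Injective (Fin.cons a z : Fin (N + 1) → ℝ) := fun hz ha =>
    Fin.cons_injective_iff.2 ⟨by rintro ⟨s, hs⟩; exact ha s hs, hz⟩
  have hrepb : ∀ {z τ : Fin N → ℝ} {t : ℝ},
      (∀ j < n, c (j + 1) = (∑ s, z s ^ j * τ s) + a ^ j * t) → ∀ l, l + 1 < n →
      -c (l + 2) + b * c (l + 1) =
        ∑ s : Fin (N + 1), (Fin.cons a z : Fin (N + 1) → ℝ) s ^ l *
          (Fin.cons ((b - a) * t) (fun s => (b - z s) * τ s) : Fin (N + 1) → ℝ) s := by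
    intro z τ t hc l hl
    rw [Fin.sum_univ_succ]
    simp only [Fin.cons_zero, Fin.cons_succ]
    rw [hc (l + 1) hl, hc l (by omega), neg_add, mul_add, mul_sum, ← sum_neg_distrib,
      show ∀ x y p q : ℝ, x + y + (p + q) = y + q + (x + p) by intros; ring, ← sum_add_distrib]
    congr 1
    · ring
    · exact sum_congr rfl fun s _ => by ring
  constructor
  · rintro ⟨z, τ, t, hz, hzab, hz0, hτ, ht, hc⟩
    have hm := hrep hc
    have hw : ∀ s, 0 < (z s - a) * τ s := fun s => mul_pos (sub_pos.2 (hzab s).1) (hτ s)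
    refine ⟨fun d hd => ?_, ?_, ?_, ?_⟩
    · rw [← det_hankel_eq_zero z fun s => z s ^ d * ((z s - a) * τ s)]
      congr 2
      ext i j
      rw [show i.1 + j.1 + 2 + d = i.1 + j.1 + d + 2 by omega,
        show i.1 + j.1 + 1 + d = i.1 + j.1 + d + 1 by omega, hm _ (by omega)]
      exact sum_congr rfl fun s _ => by ring
    · convert (posDef_hankel_iff hz).2 hw using 4 with i j
      exact hm _ (by omega)
    · have hw2 : ∀ s, 0 < z s ^ 2 * ((z s - a) * τ s) := fun s =>
        mul_pos (by have := hz0 s; positivity) (hw s)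
      convert (posDef_hankel_iff hz).2 hw2 using 4 with i j
      rw [hm (i.1 + j.1 + 2) (by omega)]
      exact sum_congr rfl fun s _ => by ring
    · have hza := hinj hz fun s => (hzab s).1.ne'
      convert (posDef_hankel_iff hza).2 ?_ using 4 with i j
      · exact hrepb hc _ (by omega)
      · refine Fin.cases ?_ fun s => ?_
        · exact mul_pos (sub_pos.2 hab) ht
        · exact mul_pos (sub_pos.2 (hzab s).2) (hτ s)
  · rintro ⟨h1, h2, h3, h4⟩
    obtain ⟨z, w, hz, hw, hm⟩ :=
      exists_quadrature_of_posDef_hankel (m := fun l => c (l + 2) - a * c (l + 1)) h2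
    have step : ∀ d, 2 * (N + 1) + d ≤ n → (∀ s, z s ^ d * w s ≠ 0) →
        (∀ l < 2 * N + d, c (l + 2) - a * c (l + 1) = ∑ s, z s ^ l * w s) →
        ∀ l < 2 * N + (d + 1), c (l + 2) - a * c (l + 1) = ∑ s, z s ^ l * w s := by
      intro d hd hne ih l hl
      rcases Nat.lt_or_ge l (2 * N + d) with hl' | hl'
      · exact ih l hl'
      · obtain rfl : l = 2 * N + d := by omega
        refine eq_sum_of_det_hankel_eq_zero (m := fun l => c (l + 2) - a * c (l + 1)) hz hne ih ?_
        rw [← h1 d hd]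
        congr 2
        ext i j
        rw [show i.1 + j.1 + 2 + d = i.1 + j.1 + d + 2 by omega,
          show i.1 + j.1 + 1 + d = i.1 + j.1 + d + 1 by omega]
    have hm1 := step 0 (by omega) (fun s => by simpa using (hw s).ne') hm
    have hz0 : ∀ s, z s ≠ 0 := by
      have := (posDef_hankel_iff (w := fun s => z s ^ 2 * w s) hz).1 (by
        convert h3 using 4 with i j
        rw [hm1 (i.1 + j.1 + 2) (by omega)]
        exact sum_congr rfl fun s _ => by ring)
      rintro s hs
      simpa [hs] using this s
    have hmd : ∀ d, 2 * (N + 1) + d ≤ n + 1 →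
        ∀ l < 2 * N + d, c (l + 2) - a * c (l + 1) = ∑ s, z s ^ l * w s := by
      intro d
      induction d with
      | zero => exact fun _ => hm
      | succ d ih =>
        exact fun hd => step d (by omega)
          (fun s => mul_ne_zero (pow_ne_zero _ (hz0 s)) (hw s).ne') (ih (by omega))
    have hza : ∀ s, z s ≠ a :=
      forall_ne_of_posDef_hankel (fun l hl => hm1 l (by omega)) h4
    have hc : ∀ j < n, c (j + 1) = (∑ s, z s ^ j * (w s / (z s - a))) +
        a ^ j * (c 1 - ∑ s, w s / (z s - a)) := by
      intro j
      induction j with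
      | zero => simp
      | succ j ih =>
        intro hj
        have e1 := hmd (n - 2 * N - 1) (by omega) j (by omega)
        have e2 : ∑ s, z s ^ (j + 1) * (w s / (z s - a)) =
            (∑ s, z s ^ j * w s) + a * ∑ s, z s ^ j * (w s / (z s - a)) := by
          rw [mul_sum, ← sum_add_distrib]
          refine sum_congr rfl fun s _ => ?_
          have := sub_ne_zero.2 (hza s)
          field_simp
          ring
        rw [e2, ← e1]
        linear_combination a * ih (by omega)
    have hpos := (posDef_hankel_iff (hinj hz hza)).1 (by
      convert h4 using 4 with i j
      exact (hrepb hc _ (by omega)).symm)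
    have hzs : ∀ s, a < z s ∧ z s < b ∧ 0 < w s / (z s - a) := by
      intro s
      have h5 : 0 < (b - z s) * (w s / (z s - a)) := hpos s.succ
      have hws := hw s
      rcases lt_or_gt_of_ne (hza s) with hlt | hgt
      · have := div_neg_of_pos_of_neg hws (sub_neg.2 hlt)
        nlinarith
      · have := div_pos hws (sub_pos.2 hgt)
        exact ⟨hgt, sub_pos.1 (pos_of_mul_pos_left h5 this.le), this⟩
    have h0 : 0 < (b - a) * (c 1 - ∑ s, w s / (z s - a)) := hpos 0
    exact ⟨z, _, _, hz, fun s => ⟨(hzs s).1, (hzs s).2.1⟩, hz0, fun s => (hzs s).2.2,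
      pos_of_mul_pos_right h0 (sub_pos.2 hab).le, hc⟩

theorem sum_Icc_two_eq_sum_fin (N : ℕ) (f : ℕ → ℝ) :
    ∑ s ∈ Icc 2 (N + 1), f s = ∑ s : Fin N, f (s.1 + 2) := by
  rw [Fin.sum_univ_eq_sum_range (fun s => f (s + 2)), range_eq_Ico, sum_Ico_add' f 0 N 2]
  rfl

/-- Part (D) of the solvability lemma for the truncated Hausdorff moment problem:
existence of a representing step function with exactly `k` nonzero points of growth,
including `a` but not `b`, for moments `c₁, …, c_n`. -/
theorem stmt_6 (n k : ℕ) (hn : 4 ≤ n) (hk : 1 ≤ k) (hkn : 2 * k ≤ n)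
    (a b : ℝ) (hab : a < b) (c : ℕ → ℝ) :
    (∃ z σ : ℕ → ℝ,
      (∀ s ∈ Icc 2 k, ∀ t ∈ Icc 2 k, s < t → z t < z s) ∧
      (∀ s ∈ Icc 2 k, a < z s ∧ z s < b) ∧
      (∀ s ∈ Icc 2 k, z s ≠ 0) ∧
      (∀ s ∈ Icc 2 (k + 1), 0 < σ s) ∧
      (∀ j ∈ Icc 1 n, c j =
        (∑ s ∈ Icc 2 k, z s ^ (j - 1) * σ s) + a ^ (j - 1) * σ (k + 1)))
    ↔
    ((∀ d : ℕ, 2 * k + d ≤ n →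
        (Matrix.of fun i j : Fin k =>
          c (i.1 + j.1 + 2 + d) - a * c (i.1 + j.1 + 1 + d)).det = 0) ∧
      (Matrix.of fun i j : Fin (k - 1) =>
        c (i.1 + j.1 + 2) - a * c (i.1 + j.1 + 1)).PosDef ∧
      (Matrix.of fun i j : Fin (k - 1) =>
        c (i.1 + j.1 + 4) - a * c (i.1 + j.1 + 3)).PosDef ∧
      (Matrix.of fun i j : Fin k =>
        -c (i.1 + j.1 + 2) + b * c (i.1 + j.1 + 1)).PosDef) := by
  obtain ⟨N, rfl⟩ : ∃ N, k = N + 1 := ⟨k - 1, by omega⟩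
  refine Iff.trans ?_ (exists_atoms_iff hkn hab c)
  constructor
  · rintro ⟨z, σ, hanti, hzab, hz0, hσ, hc⟩
    have hmem : ∀ s : Fin N, s.1 + 2 ∈ Icc 2 (N + 1) := fun s => by simp
    refine ⟨fun s => z (s.1 + 2), fun s => σ (s.1 + 2), σ (N + 2), fun s t hst => ?_,
      fun s => hzab _ (hmem s), fun s => hz0 _ (hmem s), fun s => hσ _ (by simp),
      hσ _ (by simp), fun j hj => ?_⟩
    · rcases lt_trichotomy s t with h | h | h
      · exact absurd hst (hanti _ (hmem s) _ (hmem t) (by omega)).ne'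
      · exact h
      · exact absurd hst (hanti _ (hmem t) _ (hmem s) (by omega)).ne
    · rw [hc (j + 1) (by simp; omega), sum_Icc_two_eq_sum_fin]
      simp
  · rintro ⟨z, τ, t, hz, hzab, hz0, hτ, ht, hc⟩
    set e := Tuple.sort fun s => -z s
    have hmono : Monotone fun s => -z (e s) := Tuple.monotone_sort fun s => -z s
    have hanti : ∀ s t, s < t → z (e t) < z (e s) := fun s t hst =>
      lt_of_le_of_ne (neg_le_neg_iff.1 (hmono hst.le)) fun h =>
        hst.ne' (e.injective (hz h))
    refine ⟨fun s => if h : s - 2 < N then z (e ⟨s - 2, h⟩) else 0,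
      fun s => if h : s - 2 < N then τ (e ⟨s - 2, h⟩) else t, ?_, ?_, ?_, ?_, ?_⟩
    · intro s hs r hr hsr
      rw [mem_Icc] at hs hr
      simp only [dif_pos (show s - 2 < N by omega), dif_pos (show r - 2 < N by omega)]
      exact hanti _ _ (Fin.mk_lt_mk.2 (by omega))
    · intro s hs
      rw [mem_Icc] at hs
      simp only [dif_pos (show s - 2 < N by omega)]
      exact hzab _
    · intro s hs
      rw [mem_Icc] at hs
      simp only [dif_pos (show s - 2 < N by omega)]
      exact hz0 _
    · intro s _
      dsimp only
      split_ifs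
      · exact hτ _
      · exact ht
    · intro j hj
      rw [mem_Icc] at hj
      obtain ⟨j, rfl⟩ : ∃ i, j = i + 1 := ⟨j - 1, by omega⟩
      rw [hc j (by omega), sum_Icc_two_eq_sum_fin, ← Equiv.sum_comp e]
      simp
end

section
/- Let k ≥ 2 be an integer, let a be a real number, let z₂, …, z_k be pairwise distinct real numbers with z_s > a for all s, let σ₂, …, σ_k > 0, let σ_{k+1} ≥ 0, and set c_j = Σ_{s=2}^{k} z_s^{j−1} σ_s + a^{j−1}σ_{k+1} for j = 1, …, 2k−1. Let P(z) denote the determinant of the k×k matrix whose i-th row, for i = 1,…,k−1, is (c^{a}_i, c^{a}_{i+1}, …, c^{a}_{i+k−1}) and whose k-th row is (1, z, z², …, z^{k−1}). Then P is a polynomial of degree exactly k−1 in z whose set of real roots is exactly {z₂, …, z_k}. -/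
open Finset

open Matrix in
/-- Appending a node to a Vandermonde matrix multiplies the determinant by the product of the
differences with the previous nodes. -/
theorem det_vandermonde_snoc {R : Type*} [CommRing R] {n : ℕ} (y : Fin n → R) (x : R) :
    (vandermonde (Fin.snoc y x : Fin (n + 1) → R)).det =
      (vandermonde y).det * ∏ s, (x - y s) := by
  have key (m : ℕ) (f : Fin m → Fin m → R) :
      ∏ i, ∏ j ∈ Ioi i, f i j = ∏ i, ∏ j, if i < j then f i j else 1 := by
    refine prod_congr rfl fun i _ => ?_
    rw [← prod_filter]
    congr 1
    ext j
    simp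
  rw [det_vandermonde, det_vandermonde, key, key, Fin.prod_univ_castSucc, ← prod_mul_distrib]
  simp [Fin.prod_univ_castSucc, Fin.castSucc_lt_last, not_lt.2 (Fin.le_last _)]

open Matrix in
/-- If the last row of a square matrix is the last standard basis vector, its determinant is that
of the leading principal block. -/
theorem det_of_last_row_eq_single {R : Type*} [CommRing R] {n : ℕ}
    (A : Matrix (Fin (n + 1)) (Fin (n + 1)) R) (h : A (Fin.last n) = Pi.single (Fin.last n) 1) :
    A.det = (A.submatrix Fin.castSucc Fin.castSucc).det := by
  rw [det_succ_row A (Fin.last n), Finset.sum_eq_single (Fin.last n)]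
  · simp only [h, Fin.val_last, Pi.single_eq_same, mul_one, Fin.succAbove_last]
    rw [Even.neg_one_pow ⟨n, rfl⟩, one_mul]
  · intro j _ hj
    simp [h, hj]
  · simp

open Matrix in
/-- The Hankel matrix of the moments of a discrete measure, bordered by a row of monomials, has
determinant proportional to the nodal polynomial. -/
theorem det_bordered_hankel {R : Type*} [CommRing R] {n : ℕ} (y w : Fin n → R) (x : R) :
    (Matrix.of fun i j : Fin (n + 1) =>
      if i.1 < n then ∑ s, w s * y s ^ (i.1 + j.1) else x ^ j.1).det =
      (vandermonde y).det ^ 2 * (∏ s, w s) * ∏ s, (x - y s) := by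
  let A : Matrix (Fin (n + 1)) (Fin (n + 1)) R :=
    Fin.snoc (fun i => Fin.snoc (fun s => w s * y s ^ i.1) 0) (Pi.single (Fin.last n) 1)
  have hA : A.det = (∏ s, w s) * (vandermonde y).det := by
    rw [det_of_last_row_eq_single A (by simp [A]), ← det_transpose (vandermonde y), ← det_mul_row]
    congr 1
    ext i s
    rw [submatrix_apply]
    simp [A, vandermonde_apply]
  have hmul : (Matrix.of fun i j : Fin (n + 1) =>
      if i.1 < n then ∑ s, w s * y s ^ (i.1 + j.1) else x ^ j.1) =
      A * vandermonde (Fin.snoc y x : Fin (n + 1) → R) := by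
    ext i j
    rw [mul_apply, Fin.sum_univ_castSucc]
    induction i using Fin.lastCases with
    | last => simp [A, vandermonde_apply, Fin.castSucc_ne_last]
    | cast i => simp [A, vandermonde_apply, pow_add, mul_assoc]
  rw [hmul, det_mul, hA, det_vandermonde_snoc]
  ring

/-- The determinantal polynomial built from the transformed moments
`c^{a}_j = c_{j+1} - a·c_j` of a discrete measure with masses `σ_s > 0` at pairwise
distinct points `z_s > a`, `s = 2,…,k`, and mass `σ_{k+1} ≥ 0` at `a`, has degree
exactly `k-1` and its real roots are exactly `z₂,…,z_k`. -/
theorem stmt_7 (k : ℕ) (hk : 2 ≤ k) (a : ℝ) (z σ : ℕ → ℝ)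
    (hz : ∀ s ∈ Icc 2 k, ∀ t ∈ Icc 2 k, s ≠ t → z s ≠ z t)
    (hza : ∀ s ∈ Icc 2 k, a < z s)
    (hσ : ∀ s ∈ Icc 2 k, 0 < σ s)
    (hσk1 : 0 ≤ σ (k + 1))
    (c : ℕ → ℝ)
    (hc : ∀ j ∈ Icc 1 (2 * k - 1), c j =
      (∑ s ∈ Icc 2 k, z s ^ (j - 1) * σ s) + a ^ (j - 1) * σ (k + 1)) :
    ∃ p : Polynomial ℝ,
      (∀ x : ℝ, p.eval x =
        (Matrix.of fun i j : Fin k =>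
          if i.1 + 1 < k then c (i.1 + j.1 + 2) - a * c (i.1 + j.1 + 1)
          else x ^ j.1).det) ∧
      p.degree = (k - 1 : ℕ) ∧
      (∀ x : ℝ, p.eval x = 0 ↔ ∃ s ∈ Icc 2 k, z s = x) := by
  obtain ⟨n, rfl⟩ : ∃ n, k = n + 1 := ⟨k - 1, by omega⟩
  have hmem (s : Fin n) : s.1 + 2 ∈ Icc 2 (n + 1) := by
    rw [mem_Icc]
    omega
  have hsum (f : ℕ → ℝ) : ∑ s ∈ Icc 2 (n + 1), f s = ∑ s : Fin n, f (s.1 + 2) := by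
    rw [← Ico_add_one_right_eq_Icc, sum_Ico_eq_sum_range, sum_range]
    exact sum_congr rfl fun s _ => by rw [add_comm]
  let y : Fin n → ℝ := fun s => z (s.1 + 2)
  let w : Fin n → ℝ := fun s => (z (s.1 + 2) - a) * σ (s.1 + 2)
  have hy : Function.Injective y := fun s t hst => by
    by_contra hne
    exact hz _ (hmem s) _ (hmem t) (fun h => hne (Fin.ext (by omega))) hst
  have hw : ∏ s, w s ≠ 0 := prod_ne_zero_iff.2 fun s _ =>
    (mul_pos (sub_pos.2 (hza _ (hmem s))) (hσ _ (hmem s))).ne'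
  have hC : (Matrix.vandermonde y).det ^ 2 * ∏ s, w s ≠ 0 :=
    mul_ne_zero (pow_ne_zero 2 (Matrix.det_vandermonde_ne_zero_iff.2 hy)) hw
  have hmoment (i j : ℕ) (hi : i < n) (hj : j ≤ n) :
      c (i + j + 2) - a * c (i + j + 1) = ∑ s, w s * y s ^ (i + j) := by
    rw [hc _ (mem_Icc.2 (by omega)), hc _ (mem_Icc.2 (by omega)), hsum, hsum]
    simp only [show i + j + 2 - 1 = i + j + 1 by omega, Nat.add_sub_cancel, mul_add, mul_sum]
    rw [pow_succ a, show ∀ A B C D : ℝ, A + B * a * C - (D + a * (B * C)) = A - D by intros; ring,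
      ← sum_sub_distrib]
    exact sum_congr rfl fun s _ => by simp only [w, y]; ring
  refine ⟨Polynomial.C ((Matrix.vandermonde y).det ^ 2 * ∏ s, w s) *
    ∏ s, (Polynomial.X - Polynomial.C (y s)), fun x => ?_, ?_, fun x => ?_⟩
  · simp only [Polynomial.eval_mul, Polynomial.eval_C, Polynomial.eval_prod, Polynomial.eval_sub,
      Polynomial.eval_X]
    rw [← det_bordered_hankel]
    congr 1
    ext i j
    simp only [Matrix.of_apply, add_lt_add_iff_right]
    split_ifs with hi
    · exact (hmoment i j hi (by omega)).symm
    · rfl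
  · rw [Polynomial.degree_C_mul hC, Polynomial.degree_prod]
    simp
  · simp only [Polynomial.eval_mul, Polynomial.eval_C, Polynomial.eval_prod, Polynomial.eval_sub,
      Polynomial.eval_X, mul_eq_zero, prod_eq_zero_iff, hC, false_or, mem_univ, true_and, sub_eq_zero]
    constructor
    · rintro ⟨s, rfl⟩
      exact ⟨_, hmem s, rfl⟩
    · rintro ⟨s, hs, rfl⟩
      rw [mem_Icc] at hs
      refine ⟨⟨s - 2, by omega⟩, ?_⟩
      simp only [y]
      rw [Nat.sub_add_cancel hs.1]
end

section
/- Let n ≥ 4 and k ≥ 2 be integers with 2k − 1 ≤ n, and let c₁, …, c_n be real numbers such that det {c_{i+j−1+d}}_{i,j=1}^{k} = 0 for every integer d with 0 ≤ d ≤ n + 1 − 2k, and such that det {c_{i+j+1}}_{i,j=1}^{k−1} ≠ 0. Suppose z₂, …, z_k are pairwise distinct real numbers and σ₂, …, σ_k are real numbers satisfying c_j = Σ_{s=2}^{k} z_s^{j−1} σ_s for every j = 1, …, 2k−1. Then the same representation holds for all remaining indices: c_j = Σ_{s=2}^{k} z_s^{j−1} σ_s for every j = 1, …, n. -/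
open Finset

/-- If a Hankel matrix `(a (i + j))` of size `K + 1` is singular and all its entries except the
bottom right one are moments of a measure with exactly `K` atoms, then so is that entry. -/
theorem hankel_corner_eq {F : Type*} [Field F] {K : ℕ} (x w : Fin K → F)
    (hx : Function.Injective x) (hw : ∀ s, w s ≠ 0) (a : ℕ → F)
    (ha : ∀ j < 2 * K, a j = ∑ s, w s * x s ^ j)
    (hdet : (Matrix.of fun i j : Fin (K + 1) => a (i.1 + j.1)).det = 0) :
    a (2 * K) = ∑ s, w s * x s ^ (2 * K) := by
  obtain ⟨v, hv0, hv⟩ := Matrix.exists_mulVec_eq_zero_iff.mpr hdet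
  have hrow (i : Fin (K + 1)) : ∑ j : Fin (K + 1), a (i.1 + j.1) * v j = 0 := congrFun hv i
  have hswap (i : ℕ) : ∑ j : Fin (K + 1), (∑ s, w s * x s ^ (i + j.1)) * v j =
      ∑ s, (w s * ∑ j : Fin (K + 1), v j * x s ^ j.1) * x s ^ i := by
    simp only [Finset.sum_mul, Finset.mul_sum]
    rw [Finset.sum_comm]
    exact Finset.sum_congr rfl fun s _ => Finset.sum_congr rfl fun j _ => by ring
  have hroot (s : Fin K) : ∑ j : Fin (K + 1), v j * x s ^ j.1 = 0 := by
    have h0 : (fun s => w s * ∑ j : Fin (K + 1), v j * x s ^ j.1) = 0 := by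
      refine Matrix.eq_zero_of_forall_pow_sum_mul_pow_eq_zero hx fun i => ?_
      rw [← hswap, ← hrow i.castSucc]
      refine Finset.sum_congr rfl fun j _ => ?_
      rw [Fin.val_castSucc, ha _ (by omega)]
    exact (mul_eq_zero.mp (congrFun h0 s)).resolve_left (hw s)
  have hlast : v (Fin.last K) ≠ 0 := by
    intro hl
    have h0 : (fun j : Fin K => v j.castSucc) = 0 := by
      refine Matrix.eq_zero_of_forall_index_sum_mul_pow_eq_zero hx fun s => ?_
      simpa [Fin.sum_univ_castSucc, hl] using hroot s
    exact hv0 (funext fun j => Fin.lastCases hl (fun j => congrFun h0 j) j)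
  have h1 := hrow (Fin.last K)
  have h2 := hswap K
  simp only [hroot, mul_zero, zero_mul, Finset.sum_const_zero] at h2
  rw [Fin.sum_univ_castSucc] at h1 h2
  simp only [Fin.val_last, Fin.val_castSucc, ← two_mul] at h1 h2
  rw [Finset.sum_congr rfl fun j _ => by rw [ha (K + j.1) (by omega)]] at h1
  exact mul_right_cancel₀ hlast (add_left_cancel (h1.trans h2.symm))

/-- A nonsingular Hankel matrix of moments of `K` atoms has only nonzero weights. -/
theorem weight_ne_zero_of_hankel_det_ne_zero {F : Type*} [Field F] {K : ℕ} (x w : Fin K → F)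
    (hdet : (Matrix.of fun i j : Fin K => ∑ s, w s * x s ^ (i.1 + j.1)).det ≠ 0) (s : Fin K) :
    w s ≠ 0 := by
  have hfac : (Matrix.of fun i j : Fin K => ∑ s, w s * x s ^ (i.1 + j.1)) =
      (Matrix.vandermonde x).transpose * Matrix.diagonal w * Matrix.vandermonde x := by
    ext i j
    rw [Matrix.mul_apply]
    simp only [Matrix.of_apply, Matrix.mul_diagonal, Matrix.transpose_apply,
      Matrix.vandermonde_apply]
    exact Finset.sum_congr rfl fun s _ => by ring
  rw [hfac, Matrix.det_mul, Matrix.det_mul, Matrix.det_diagonal] at hdet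
  exact Finset.prod_ne_zero_iff.mp (right_ne_zero_of_mul (left_ne_zero_of_mul hdet)) s
    (Finset.mem_univ s)

/-- If all shifted `k×k` Hankel determinants of `c₁,…,c_n` vanish, the shifted
`(k-1)×(k-1)` Hankel determinant is nonzero, and the first `2k-1` moments admit a
discrete representation on `k-1` distinct points, then all `n` moments admit the same
representation. -/
theorem stmt_14 (n k : ℕ) (hn : 4 ≤ n) (hk : 2 ≤ k) (hkn : 2 * k - 1 ≤ n)
    (c : ℕ → ℝ)
    (hdet : ∀ d : ℕ, 2 * k + d ≤ n + 1 →
      (Matrix.of fun i j : Fin k => c (i.1 + j.1 + 1 + d)).det = 0)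
    (hdet' : (Matrix.of fun i j : Fin (k - 1) => c (i.1 + j.1 + 3)).det ≠ 0)
    (z σ : ℕ → ℝ)
    (hz : ∀ s ∈ Icc 2 k, ∀ t ∈ Icc 2 k, s ≠ t → z s ≠ z t)
    (hc : ∀ j ∈ Icc 1 (2 * k - 1), c j = ∑ s ∈ Icc 2 k, z s ^ (j - 1) * σ s) :
    ∀ j ∈ Icc 1 n, c j = ∑ s ∈ Icc 2 k, z s ^ (j - 1) * σ s := by
  obtain ⟨K, rfl⟩ : ∃ K, k = K + 1 := ⟨k - 1, by omega⟩
  rw [Nat.add_sub_cancel] at hdet'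
  set x : Fin K → ℝ := fun s => z (2 + s.1)
  set w : Fin K → ℝ := fun s => σ (2 + s.1)
  have hsum (f : ℕ → ℝ) : ∑ s ∈ Icc 2 (K + 1), f s = ∑ s : Fin K, f (2 + s.1) := by
    rw [← Finset.Ico_add_one_right_eq_Icc, Finset.sum_Ico_eq_sum_range, Finset.sum_range]
    rfl
  have hx : Function.Injective x := by
    intro s t hst
    by_contra hne
    exact hz _ (mem_Icc.mpr (by omega)) _ (mem_Icc.mpr (by omega))
      (fun h => hne (Fin.ext (by omega))) hst
  have hw (s : Fin K) : w s * x s ^ 2 ≠ 0 := by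
    refine weight_ne_zero_of_hankel_det_ne_zero x (fun s => w s * x s ^ 2) ?_ s
    refine ne_of_eq_of_ne (congrArg Matrix.det ?_) hdet'
    ext i j
    rw [Matrix.of_apply, Matrix.of_apply, hc _ (mem_Icc.mpr (by omega)), hsum]
    refine Finset.sum_congr rfl fun s _ => ?_
    rw [show i.1 + j.1 + 3 - 1 = i.1 + j.1 + 2 by omega]
    ring
  intro m
  induction m using Nat.strong_induction_on with
  | _ m ih =>
    intro hm
    rw [mem_Icc] at hm
    by_cases hle : m ≤ 2 * (K + 1) - 1
    · exact hc m (mem_Icc.mpr ⟨hm.1, hle⟩)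
    obtain ⟨d, rfl⟩ : ∃ d, m = 2 * K + 1 + d := ⟨m - (2 * K + 1), by omega⟩
    have key := hankel_corner_eq x (fun s => w s * x s ^ d) hx
      (fun s => mul_ne_zero (left_ne_zero_of_mul (hw s))
        (pow_ne_zero _ (pow_ne_zero_iff two_ne_zero |>.mp (right_ne_zero_of_mul (hw s)))))
      (fun j => c (j + 1 + d)) (fun j hj => ?_) (hdet d (by omega))
    · rw [hsum]
      refine key.trans (Finset.sum_congr rfl fun s _ => ?_)
      rw [show 2 * K + 1 + d - 1 = 2 * K + d by omega]
      ring
    · rw [ih _ (by omega) (mem_Icc.mpr (by omega)), hsum]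
      refine Finset.sum_congr rfl fun s _ => ?_
      rw [show j + 1 + d - 1 = j + d by omega]
      ring
end
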